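/- arXiv:0708.2312 — 8 statements merged into one kernel-verified Lean document; each statement's English description precedes it below -/
import Mathlib

section
/- If S ⊆ I is equivalent to a triangular set, then B₀(S) is a Markov basis for S. -/
open Finset

/-- A move for the subtable sum problem: all row sums and column sums are zero,
and the sum over the subtable `S` is zero. -/
def isMove {R C : ℕ} (S : Finset (Fin R × Fin C)) (z : Fin R × Fin C → ℤ) : Prop :=
  (∀ i : Fin R, ∑ j : Fin C, z (i, j) = 0) ∧
  (∀ j : Fin C, ∑ i : Fin R, z (i, j) = 0) ∧
  (∑ p ∈ S, z p = 0)

/-- Two tables lie in the same `S`-fiber: equal row sums, column sums and `S`-sums. -/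
def sameFiber {R C : ℕ} (S : Finset (Fin R × Fin C)) (x y : Fin R × Fin C → ℕ) : Prop :=
  (∀ i : Fin R, ∑ j : Fin C, x (i, j) = ∑ j : Fin C, y (i, j)) ∧
  (∀ j : Fin C, ∑ i : Fin R, x (i, j) = ∑ i : Fin R, y (i, j)) ∧
  (∑ p ∈ S, x p = ∑ p ∈ S, y p)

/-- The basic move `B(i,i';j,j')`: +1 at `(i,j)` and `(i',j')`, −1 at `(i,j')` and `(i',j)`. -/
def basicMove {R C : ℕ} (i i' : Fin R) (j j' : Fin C) : Fin R × Fin C → ℤ := fun p =>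
  (if p = (i, j) then 1 else 0) + (if p = (i', j') then 1 else 0)
    - (if p = (i, j') then 1 else 0) - (if p = (i', j) then 1 else 0)

/-- `B₀(S)`: the set of basic moves that are moves for `S`. -/
def B0 {R C : ℕ} (S : Finset (Fin R × Fin C)) : Set (Fin R × Fin C → ℤ) :=
  { z | ∃ i i' : Fin R, ∃ j j' : Fin C, i ≠ i' ∧ j ≠ j' ∧
      z = basicMove i i' j j' ∧ isMove S z }

/-- `ℬ` is a Markov basis for `S`: a finite, sign-invariant set of moves for `S` connecting
any two distinct tables of a common `S`-fiber while staying nonnegative along the way. -/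
def isMarkovBasis {R C : ℕ} (S : Finset (Fin R × Fin C))
    (ℬ : Set (Fin R × Fin C → ℤ)) : Prop :=
  ℬ.Finite ∧ (∀ z ∈ ℬ, isMove S z) ∧ (∀ z ∈ ℬ, -z ∈ ℬ) ∧
  ∀ x y : Fin R × Fin C → ℕ, sameFiber S x y → x ≠ y →
    ∃ (α : ℕ) (B : ℕ → (Fin R × Fin C → ℤ)),
      0 < α ∧ (∀ t < α, B t ∈ ℬ) ∧
      (∀ p, (y p : ℤ) = (x p : ℤ) + ∑ t ∈ Finset.range α, B t p) ∧
      (∀ a, 1 ≤ a → a ≤ α → ∀ p, 0 ≤ (x p : ℤ) + ∑ t ∈ Finset.range a, B t p)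

/-- `‖X − Y‖₁` can be reduced by `B₀(S)` (Definition 2 of the paper). -/
def normReducible {R C : ℕ} (S : Finset (Fin R × Fin C))
    (x y : Fin R × Fin C → ℕ) : Prop :=
  ∃ (τp τm : ℕ) (Bp Bm : ℕ → (Fin R × Fin C → ℤ)),
    0 < τp + τm ∧
    (∀ t < τp, Bp t ∈ B0 S) ∧ (∀ t < τm, Bm t ∈ B0 S) ∧
    (∀ a, 1 ≤ a → a ≤ τp → ∀ p, 0 ≤ (x p : ℤ) + ∑ t ∈ Finset.range a, Bp t p) ∧
    (∀ a, 1 ≤ a → a ≤ τm → ∀ p, 0 ≤ (y p : ℤ) - ∑ t ∈ Finset.range a, Bm t p) ∧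
    (∑ p : Fin R × Fin C,
        |(x p : ℤ) - (y p : ℤ) + ∑ t ∈ Finset.range τp, Bp t p
          + ∑ t ∈ Finset.range τm, Bm t p|)
      < ∑ p : Fin R × Fin C, |(x p : ℤ) - (y p : ℤ)|

/-- `T` exhibits pattern `P`. -/
def patternP {R C : ℕ} (T : Finset (Fin R × Fin C)) : Prop :=
  ∃ i₁ i₂ : Fin R, ∃ j₁ j₂ j₃ : Fin C,
    i₁ ≠ i₂ ∧ j₁ ≠ j₂ ∧ j₁ ≠ j₃ ∧ j₂ ≠ j₃ ∧
    (i₁, j₁) ∈ T ∧ (i₂, j₂) ∈ T ∧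
    (i₁, j₂) ∉ T ∧ (i₂, j₁) ∉ T ∧ (i₁, j₃) ∉ T ∧ (i₂, j₃) ∉ T

/-- `T` exhibits pattern `Pᵗ` (the transpose of pattern `P`). -/
def patternPt {R C : ℕ} (T : Finset (Fin R × Fin C)) : Prop :=
  ∃ i₁ i₂ i₃ : Fin R, ∃ j₁ j₂ : Fin C,
    i₁ ≠ i₂ ∧ i₁ ≠ i₃ ∧ i₂ ≠ i₃ ∧ j₁ ≠ j₂ ∧
    (i₁, j₁) ∈ T ∧ (i₂, j₂) ∈ T ∧
    (i₂, j₁) ∉ T ∧ (i₁, j₂) ∉ T ∧ (i₃, j₁) ∉ T ∧ (i₃, j₂) ∉ T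

/-- `S` is equivalent to a 2×2 block diagonal set. -/
def isBlockDiag {R C : ℕ} (S : Finset (Fin R × Fin C)) : Prop :=
  ∃ (R₁ : Finset (Fin R)) (C₁ : Finset (Fin C)),
    R₁.Nonempty ∧ R₁ ≠ Finset.univ ∧ C₁.Nonempty ∧ C₁ ≠ Finset.univ ∧
    S = R₁ ×ˢ C₁ ∪ R₁ᶜ ×ˢ C₁ᶜ

/-- `S` is equivalent to a triangular set: its row slices are totally ordered by inclusion. -/
def isTriangular {R C : ℕ} (S : Finset (Fin R × Fin C)) : Prop :=
  ∀ i i' : Fin R,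
    (∀ j : Fin C, (i, j) ∈ S → (i', j) ∈ S) ∨ (∀ j : Fin C, (i', j) ∈ S → (i, j) ∈ S)

/-- Two cells lie in the same block of `S`: equal row slices and equal column slices. -/
def sameBlock {R C : ℕ} (S : Finset (Fin R × Fin C)) (p q : Fin R × Fin C) : Prop :=
  (∀ j : Fin C, (p.1, j) ∈ S ↔ (q.1, j) ∈ S) ∧ (∀ i : Fin R, (i, p.2) ∈ S ↔ (i, q.2) ∈ S)

/-- The `n × (n+1)` staircase set `{(i,j) : j ≤ i}` (with 1-based numbering), all of whose
blocks are single cells. -/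
def staircase (n : ℕ) : Finset (Fin n × Fin (n + 1)) :=
  Finset.univ.filter (fun p => (p.2 : ℕ) ≤ (p.1 : ℕ))

/-- Condition (★) with threshold `i₀`: rows up to `i₀` are nonnegative at both boundary
columns, and rows after `i₀` are nonpositive there. -/
def starCond {n : ℕ} (z : Fin n × Fin (n + 1) → ℤ) (i₀ : Fin n) : Prop :=
  (∀ i : Fin n, i ≤ i₀ → 0 ≤ z (i, 0) ∧ 0 ≤ z (i, Fin.last n)) ∧
  (∀ i : Fin n, i₀ < i → z (i, 0) ≤ 0 ∧ z (i, Fin.last n) ≤ 0)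

/-- `i₁` is a last nonzero boundary row of `z`. -/
def lastBoundaryRow {n : ℕ} (z : Fin n × Fin (n + 1) → ℤ) (i₁ : Fin n) : Prop :=
  z (i₁, 0) ≤ 0 ∧ z (i₁, Fin.last n) ≤ 0 ∧
  (z (i₁, 0) < 0 ∨ z (i₁, Fin.last n) < 0) ∧
  (∀ i : Fin n, i₁ < i → z (i, 0) = 0 ∧ z (i, Fin.last n) = 0)

set_option linter.unusedSectionVars false

/-- Product form of the basic move. -/
def tbm {ι κ : Type} [DecidableEq ι] [DecidableEq κ] (i i' : ι) (j j' : κ) (a : ι) (b : κ) : ℤ :=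
  ((if a = i then 1 else 0) - (if a = i' then 1 else 0)) *
    ((if b = j then 1 else 0) - (if b = j' then 1 else 0))

/-- One allowed swap. -/
def tstep {ι κ : Type} [DecidableEq ι] [DecidableEq κ] (w : ι → κ → ℤ) (x y : ι → κ → ℤ) : Prop :=
  ∃ i i' j j', i ≠ i' ∧ j ≠ j' ∧ w i j + w i' j' = w i j' + w i' j ∧
    (∀ a b, 0 ≤ y a b) ∧ ∀ a b, y a b = x a b + tbm i i' j j' a b

/-- Fiber. -/
structure tfib {ι κ : Type} [Fintype ι] [Fintype κ] (w : ι → κ → ℤ) (ρ : ι → ℤ) (γ : κ → ℤ) (k : ℤ)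
    (x : ι → κ → ℤ) : Prop where
  nn : ∀ a b, 0 ≤ x a b
  row : ∀ a, ∑ b, x a b = ρ a
  col : ∀ b, ∑ a, x a b = γ b
  sub : ∑ a, ∑ b, w a b * x a b = k

section
variable {ι κ : Type} [Fintype ι] [Fintype κ] [DecidableEq ι] [DecidableEq κ]

lemma tbm_row (i i' : ι) (j j' : κ) (a : ι) : ∑ b, tbm i i' j j' a b = 0 := by
  simp [tbm, ← Finset.mul_sum, Finset.sum_sub_distrib]

lemma tbm_col (i i' : ι) (j j' : κ) (b : κ) : ∑ a, tbm i i' j j' a b = 0 := by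
  simp [tbm, ← Finset.sum_mul, Finset.sum_sub_distrib]

lemma tbm_sub (w : ι → κ → ℤ) (i i' : ι) (j j' : κ) :
    ∑ a, ∑ b, w a b * tbm i i' j j' a b = w i j + w i' j' - w i j' - w i' j := by
  have h1 : ∀ a, ∑ b, w a b * tbm i i' j j' a b =
      ((if a = i then 1 else 0) - (if a = i' then 1 else 0)) * (w a j - w a j') := by
    intro a
    have : ∀ b, w a b * tbm i i' j j' a b =
      ((if a = i then 1 else 0) - (if a = i' then 1 else 0)) *
        ((if b = j then w a b else 0) - (if b = j' then w a b else 0)) := by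
      intro b
      unfold tbm
      split_ifs <;> ring
    simp_rw [this]
    rw [← Finset.mul_sum, Finset.sum_sub_distrib]
    simp
  simp_rw [h1, sub_mul, ite_mul, one_mul, zero_mul]
  rw [Finset.sum_sub_distrib]
  simp
  ring

lemma tfib_step {w : ι → κ → ℤ} {ρ γ k} {x y : ι → κ → ℤ} (hx : tfib w ρ γ k x)
    (h : tstep w x y) : tfib w ρ γ k y := by
  obtain ⟨i, i', j, j', _, _, hw, hn, he⟩ := h
  refine ⟨hn, fun a => ?_, fun b => ?_, ?_⟩
  · simp_rw [he, Finset.sum_add_distrib, tbm_row, hx.row, add_zero]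
  · simp_rw [he, Finset.sum_add_distrib, tbm_col, hx.col, add_zero]
  · simp_rw [he, mul_add, Finset.sum_add_distrib, tbm_sub, hx.sub]
    linarith

abbrev tconn (w : ι → κ → ℤ) := Relation.ReflTransGen (tstep w)

lemma tfib_conn {w : ι → κ → ℤ} {ρ γ k} {x y : ι → κ → ℤ} (hx : tfib w ρ γ k x)
    (h : tconn w x y) : tfib w ρ γ k y := by
  induction h with
  | refl => exact hx
  | tail _ h ih => exact tfib_step ih h

lemma tstep_symm {w : ι → κ → ℤ} {x y : ι → κ → ℤ} (hx : ∀ a b, 0 ≤ x a b)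
    (h : tstep w x y) : tstep w y x := by
  obtain ⟨i, i', j, j', hi, hj, hw, hn, he⟩ := h
  refine ⟨i', i, j, j', hi.symm, hj, by linarith, hx, fun a b => ?_⟩
  rw [he]; unfold tbm; ring

lemma tconn_symm {w : ι → κ → ℤ} {ρ γ k} {x y : ι → κ → ℤ} (hx : tfib w ρ γ k x)
    (h : tconn w x y) : tconn w y x := by
  induction h with
  | refl => exact .refl
  | tail h1 h2 ih => exact .head (tstep_symm (tfib_conn hx h1).nn h2) ih

/-- Swap into column `j0`. -/
lemma tswap {w : ι → κ → ℤ} {x : ι → κ → ℤ} {i a : ι} {j0 j : κ}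
    (hx : ∀ a b, 0 ≤ x a b) (h1 : 0 < x i j0) (h2 : 0 < x a j) (hne : a ≠ i)
    (hw0 : w i j0 = w a j0) (hw : w i j = w a j) :
    ∃ x', tconn w x x' ∧ 0 < x' a j0 ∧ ∀ c, c ≠ a → c ≠ i → ∀ b, x' c b = x c b := by
  by_cases hj : j0 = j
  · subst hj
    exact ⟨x, .refl, h2, fun _ _ _ _ => rfl⟩
  · refine ⟨fun c b => x c b + tbm a i j0 j c b, .single ⟨a, i, j0, j, hne, hj, by linarith,
      fun c b => ?_, fun _ _ => rfl⟩, ?_, ?_⟩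
    · have := hx c b
      clear hx
      simp only [tbm]
      by_cases c1 : c = a <;> by_cases c2 : c = i <;> by_cases b1 : b = j0 <;>
        by_cases b2 : b = j <;> subst_vars <;> simp_all <;> omega
    · have := hx a j0
      simp [tbm, hne, hj]
      omega
    · intro c h h' b
      simp [tbm, h, h']

lemma tmeet {w : ι → κ → ℤ} (hw : ∀ a b, w a b = 0 ∨ w a b = 1) (r : ι → ℤ)
    (hr : ∀ a b, r a ≤ r b → ∀ j, w a j ≤ w b j) {ρ γ k} (j0 : κ)
    (hfull : ∀ a, 0 < ρ a → w a j0 = 1) (n : ℕ) :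
    ∀ (x y : ι → κ → ℤ) (i i' : ι), tfib w ρ γ k x → tfib w ρ γ k y → 0 < x i j0 → 0 < y i' j0 →
      r i ≤ r i' → r i' - r i ≤ n →
      ∃ x' y' a, tconn w x x' ∧ tconn w y y' ∧ 0 < x' a j0 ∧ 0 < y' a j0 := by
  -- positivity of rows
  have pos : ∀ x, tfib w ρ γ k x → ∀ a b, 0 < x a b → 0 < ρ a := by
    intro x hx a b h
    rw [← hx.row a]
    exact lt_of_lt_of_le h (Finset.single_le_sum (fun b _ => hx.nn a b) (Finset.mem_univ b))
  have ex : ∀ x, tfib w ρ γ k x → ∀ a, 0 < ρ a → ∃ b, 0 < x a b := by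
    intro x hx a h
    rw [← hx.row a] at h
    obtain ⟨b, _, hb⟩ := Finset.exists_lt_of_sum_lt (s := Finset.univ) (f := fun _ => (0:ℤ))
      (g := fun b => x a b) (by simpa using h)
    exact ⟨b, hb⟩
  have up : ∀ x, tfib w ρ γ k x → ∀ i a j, 0 < x i j0 → 0 < x a j → a ≠ i → r i ≤ r a →
      w a j = 0 →
      ∃ x', tconn w x x' ∧ 0 < x' a j0 ∧ ∀ c, c ≠ a → c ≠ i → ∀ b, x' c b = x c b := by
    intro x hx i a j h1 h2 hne hle h0
    refine tswap hx.nn h1 h2 hne ?_ ?_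
    · rw [hfull _ (pos x hx _ _ h1), hfull _ (pos x hx _ _ h2)]
    · have := hr _ _ hle j
      rcases hw i j with h | h <;> omega
  have down : ∀ x, tfib w ρ γ k x → ∀ i a j, 0 < x i j0 → 0 < x a j → a ≠ i → r a ≤ r i →
      w a j = 1 →
      ∃ x', tconn w x x' ∧ 0 < x' a j0 ∧ ∀ c, c ≠ a → c ≠ i → ∀ b, x' c b = x c b := by
    intro x hx i a j h1 h2 hne hle h0
    refine tswap hx.nn h1 h2 hne ?_ ?_
    · rw [hfull _ (pos x hx _ _ h1), hfull _ (pos x hx _ _ h2)]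
    · have := hr _ _ hle j
      rcases hw i j with h | h <;> omega
  -- reaching a row between two reachable ones
  have between : ∀ x x2, tfib w ρ γ k x → ∀ i i2 a, 0 < x i j0 → 0 < x2 i2 j0 →
      tconn w x x2 → (∀ c, c ≠ i2 → c ≠ i → ∀ b, x2 c b = x c b) → 0 < ρ a →
      ((r i ≤ r a ∧ r a ≤ r i2) ∨ (r i2 ≤ r a ∧ r a ≤ r i)) →
      ∃ x', tconn w x x' ∧ 0 < x' a j0 := by
    intro x x2 hx i i2 a h1 h2 hc hag hρ hb
    by_cases e1 : a = i
    · subst e1; exact ⟨x, .refl, h1⟩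
    by_cases e2 : a = i2
    · subst e2; exact ⟨x2, hc, h2⟩
    obtain ⟨j, hj⟩ := ex x hx a hρ
    have hj2 : 0 < x2 a j := by rw [hag a e2 e1]; exact hj
    have hx2 := tfib_conn hx hc
    rcases hb with ⟨b1, b2⟩ | ⟨b1, b2⟩ <;> rcases hw a j with h | h
    · obtain ⟨x', p, q, _⟩ := up x hx i a j h1 hj e1 b1 h
      exact ⟨x', p, q⟩
    · obtain ⟨x', p, q, _⟩ := down x2 hx2 i2 a j h2 hj2 e2 b2 h
      exact ⟨x', hc.trans p, q⟩
    · obtain ⟨x', p, q, _⟩ := up x2 hx2 i2 a j h2 hj2 e2 b1 h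
      exact ⟨x', hc.trans p, q⟩
    · obtain ⟨x', p, q, _⟩ := down x hx i a j h1 hj e1 b2 h
      exact ⟨x', p, q⟩
  induction n with
  | zero =>
    intro x y i i' hx hy h1 h2 hle hn
    have : r i = r i' := by push_cast at hn; omega
    obtain ⟨x', p, q⟩ := between x x hx i i i' h1 h1 .refl (fun _ _ _ _ => rfl)
      (pos y hy _ _ h2) (by omega)
    exact ⟨x', y, i', p, .refl, q, h2⟩
  | succ n ih =>
    intro x y i i' hx hy h1 h2 hle hn
    push_cast at hn
    by_cases heq : r i' - r i ≤ n
    · exact ih x y i i' hx hy h1 h2 hle heq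
    by_cases hA : ∃ i2 j, r i < r i2 ∧ 0 < x i2 j ∧ w i2 j = 0
    · obtain ⟨i2, j, hlt, hp, h0⟩ := hA
      obtain ⟨x2, hc, hq, hag⟩ := up x hx i i2 j h1 hp (by rintro rfl; omega) hlt.le h0
      by_cases hcmp : r i2 < r i'
      · obtain ⟨x', y', a, p1, p2, p3⟩ := ih x2 y i2 i' (tfib_conn hx hc) hy hq h2 hcmp.le (by omega)
        exact ⟨x', y', a, hc.trans p1, p2, p3⟩
      · obtain ⟨x', p, q⟩ := between x x2 hx i i2 i' h1 hq hc hag (pos y hy _ _ h2) (by omega)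
        exact ⟨x', y, i', p, .refl, q, h2⟩
    by_cases hB : ∃ i2 j, r i2 < r i' ∧ 0 < y i2 j ∧ w i2 j = 1
    · obtain ⟨i2, j, hlt, hp, h0⟩ := hB
      obtain ⟨y2, hc, hq, hag⟩ := down y hy i' i2 j h2 hp (by rintro rfl; omega) hlt.le h0
      by_cases hcmp : r i < r i2
      · obtain ⟨x', y', a, p1, p2, p3⟩ := ih x y2 i i2 hx (tfib_conn hy hc) h1 hq hcmp.le (by omega)
        exact ⟨x', y', a, p1, hc.trans p2, p3⟩
      · obtain ⟨y', p, q⟩ := between y y2 hy i' i2 i h2 hq hc hag (pos x hx _ _ h1) (by omega)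
        exact ⟨x, y', i, .refl, p, h1, q⟩
    exfalso
    push Not at hA hB
    have hlt : r i < r i' := by omega
    have wn : ∀ a b, 0 ≤ w a b := fun a b => by rcases hw a b with h | h <;> omega
    have gz : ∀ a, r a < r i' → ∀ b, w a b * y a b = 0 := by
      intro a ha b
      rcases hw a b with h | h
      · simp [h]
      · have := hB a b ha
        have h3 := hy.nn a b
        have : y a b = 0 := by
          by_contra hne
          exact this (by omega) h
        simp [this]
    have fnn : ∀ a, 0 ≤ ∑ b, w a b * x a b := fun a =>
      Finset.sum_nonneg (fun b _ => mul_nonneg (wn a b) (hx.nn a b))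
    have : ∑ a, ∑ b, w a b * y a b < ∑ a, ∑ b, w a b * x a b := by
      apply Finset.sum_lt_sum
      · intro a _
        by_cases ha : r a < r i'
        · rw [Finset.sum_eq_zero (fun b _ => gz a ha b)]
          exact fnn a
        · have hf : ∑ b, w a b * x a b = ∑ b, x a b := by
            apply Finset.sum_congr rfl
            intro b _
            rcases hw a b with h | h
            · have h4 := hA a b (by omega)
              have h3 := hx.nn a b
              have : x a b = 0 := by
                by_contra hne
                exact h4 (by omega) h
              simp [this]
            · simp [h]
          rw [hf, hx.row, ← hy.row]
          apply Finset.sum_le_sum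
          intro b _
          have := hy.nn a b
          rcases hw a b with h | h <;> simp [h, this]
      · refine ⟨i, Finset.mem_univ _, ?_⟩
        rw [Finset.sum_eq_zero (fun b _ => gz i hlt b)]
        apply Finset.sum_pos' (fun b _ => mul_nonneg (wn i b) (hx.nn i b))
        refine ⟨j0, Finset.mem_univ _, ?_⟩
        rw [hfull i (pos x hx _ _ h1)]
        simpa using h1
    rw [hx.sub, hy.sub] at this
    exact lt_irrefl _ this

lemma tmeet' {w : ι → κ → ℤ} (hw : ∀ a b, w a b = 0 ∨ w a b = 1) (r : ι → ℤ)
    (hr : ∀ a b, r a ≤ r b → ∀ j, w a j ≤ w b j) {ρ γ k} (j0 : κ) (hj0 : 0 < γ j0)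
    (hfull : ∀ a, 0 < ρ a → w a j0 = 1)
    (x y : ι → κ → ℤ) (hx : tfib w ρ γ k x) (hy : tfib w ρ γ k y) :
      ∃ x' y' a b, tconn w x x' ∧ tconn w y y' ∧ 0 < x' a b ∧ 0 < y' a b := by
  have ex : ∀ x, tfib w ρ γ k x → ∃ a, 0 < x a j0 := by
    intro x hx
    rw [← hx.col] at hj0
    obtain ⟨b, _, hb⟩ := Finset.exists_lt_of_sum_lt (s := Finset.univ) (f := fun _ => (0:ℤ))
      (g := fun a => x a j0) (by simpa using hj0)
    exact ⟨b, hb⟩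
  obtain ⟨i, hi⟩ := ex x hx
  obtain ⟨i', hi'⟩ := ex y hy
  rcases le_total (r i) (r i') with h | h
  · obtain ⟨x', y', a, p⟩ := tmeet hw r hr j0 hfull (r i' - r i).toNat x y i i' hx hy hi hi' h
      (by omega)
    exact ⟨x', y', a, j0, p⟩
  · obtain ⟨y', x', a, p, q, p', q'⟩ := tmeet hw r hr j0 hfull (r i - r i').toNat y x i' i hy hx
      hi' hi h (by omega)
    exact ⟨x', y', a, j0, q, p, q', p'⟩

lemma trank {w : ι → κ → ℤ} (hn : ∀ a b, (∀ j, w a j ≤ w b j) ∨ (∀ j, w b j ≤ w a j)) :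
    ∀ a b, ∑ j, w a j ≤ ∑ j, w b j → ∀ j, w a j ≤ w b j := by
  intro a b h
  rcases hn a b with h' | h'
  · exact h'
  · have he := le_antisymm h (Finset.sum_le_sum (fun j _ => h' j))
    have := (Finset.sum_eq_sum_iff_of_le (fun j _ => h' j)).1 he.symm
    intro j
    exact (this j (Finset.mem_univ j)).ge

lemma tstep_transpose {w : ι → κ → ℤ} {x y : κ → ι → ℤ}
    (h : tstep (fun b a => 1 - w a b) x y) : tstep w (fun a b => x b a) (fun a b => y b a) := by
  obtain ⟨i, i', j, j', hi, hj, hw', hn, he⟩ := h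
  refine ⟨j, j', i, i', hj, hi, by linarith, fun a b => hn b a, fun a b => ?_⟩
  simp only [he, tbm]; ring

lemma tconn_transpose {w : ι → κ → ℤ} {x y : κ → ι → ℤ}
    (h : tconn (fun b a => 1 - w a b) x y) : tconn w (fun a b => x b a) (fun a b => y b a) := by
  induction h with
  | refl => exact .refl
  | tail _ h ih => exact ih.tail (tstep_transpose h)

lemma tfib_transpose {w : ι → κ → ℤ} {ρ γ k} {x : ι → κ → ℤ} (h : tfib w ρ γ k x) :
    tfib (fun b a => 1 - w a b) γ ρ ((∑ a, ρ a) - k) (fun b a => x a b) := by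
  refine ⟨fun a b => h.nn b a, h.col, h.row, ?_⟩
  rw [Finset.sum_comm]
  simp_rw [sub_mul, Finset.sum_sub_distrib, one_mul, h.row, h.sub]

lemma tmeet_all {w : ι → κ → ℤ} (hw : ∀ a b, w a b = 0 ∨ w a b = 1)
    (hn : ∀ a b, (∀ j, w a j ≤ w b j) ∨ (∀ j, w b j ≤ w a j)) {ρ γ k}
    (x y : ι → κ → ℤ) (hx : tfib w ρ γ k x) (hy : tfib w ρ γ k y) (hp : ∃ a, 0 < ρ a) :
      ∃ x' y' a b, tconn w x x' ∧ tconn w y y' ∧ 0 < x' a b ∧ 0 < y' a b := by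
  have hr := trank hn
  obtain ⟨a0, ha0⟩ := hp
  obtain ⟨i0, hi0, hmin⟩ := Finset.exists_min_image (Finset.univ.filter (fun a => 0 < ρ a))
    (fun a => ∑ j, w a j) ⟨a0, by simpa using ha0⟩
  simp only [Finset.mem_filter, Finset.mem_univ, true_and] at hi0 hmin
  by_cases hc : ∃ b, 0 < γ b ∧ w i0 b = 1
  · obtain ⟨j0, hj0, h1⟩ := hc
    refine tmeet' hw _ hr j0 hj0 (fun a ha => ?_) x y hx hy
    have := hr _ _ (hmin a ha) j0
    rcases hw a j0 with h | h <;> omega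
  · push Not at hc
    have hn' : ∀ a b, (∀ j, 1 - w j a ≤ 1 - w j b) ∨ (∀ j, 1 - w j b ≤ 1 - w j a) := by
      intro a b
      by_contra hcon
      push Not at hcon
      obtain ⟨⟨i, hi⟩, ⟨j, hj⟩⟩ := hcon
      rcases hn i j with h | h
      · have h1 := h a
        have h2 := h b
        rcases hw i a with e1 | e1 <;> rcases hw i b with e2 | e2 <;>
        rcases hw j a with e3 | e3 <;> rcases hw j b with e4 | e4 <;> omega
      · have h1 := h a
        have h2 := h b
        rcases hw i a with e1 | e1 <;> rcases hw i b with e2 | e2 <;>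
        rcases hw j a with e3 | e3 <;> rcases hw j b with e4 | e4 <;> omega
    obtain ⟨x', y', b, a, p1, p2, p3, p4⟩ := tmeet' (w := fun b a => 1 - w a b)
      (fun b a => by rcases hw a b with h | h <;> simp [h]) _ (trank hn') i0 hi0
      (fun b hb => by
        have := hc b hb
        rcases hw i0 b with h | h <;> simp_all) _ _ (tfib_transpose hx) (tfib_transpose hy)
    exact ⟨_, _, a, b, tconn_transpose p1, tconn_transpose p2, p3, p4⟩

/-- Adding a nonnegative table. -/
lemma tconn_add {w : ι → κ → ℤ} {x y : ι → κ → ℤ} (e : ι → κ → ℤ) (he : ∀ a b, 0 ≤ e a b)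
    (h : tconn w x y) : tconn w (fun a b => x a b + e a b) (fun a b => y a b + e a b) := by
  induction h with
  | refl => exact .refl
  | tail _ h ih =>
    refine ih.tail ?_
    obtain ⟨i, i', j, j', hi, hj, hw', hn, hh⟩ := h
    refine ⟨i, i', j, j', hi, hj, hw', fun a b => add_nonneg (hn a b) (he a b), fun a b => ?_⟩
    simp only [hh]; ring

lemma tconn_all {w : ι → κ → ℤ} (hw : ∀ a b, w a b = 0 ∨ w a b = 1)
    (hn : ∀ a b, (∀ j, w a j ≤ w b j) ∨ (∀ j, w b j ≤ w a j)) (n : ℕ) :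
    ∀ ρ γ k (x y : ι → κ → ℤ), tfib w ρ γ k x → tfib w ρ γ k y → ∑ a, ρ a ≤ n → tconn w x y := by
  induction n with
  | zero =>
    intro ρ γ k x y hx hy hs
    have z : ∀ x, tfib w ρ γ k x → x = fun _ _ => 0 := by
      intro x hx
      simp_rw [← hx.row] at hs
      have h0 : ∑ a, ∑ b, x a b = 0 := le_antisymm (by simpa using hs)
        (Finset.sum_nonneg fun a _ => Finset.sum_nonneg fun b _ => hx.nn a b)
      funext a b
      have h1 := (Finset.sum_eq_zero_iff_of_nonneg
        (fun a _ => Finset.sum_nonneg fun b _ => hx.nn a b)).1 h0 a (Finset.mem_univ a)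
      exact (Finset.sum_eq_zero_iff_of_nonneg (fun b _ => hx.nn a b)).1 h1 b (Finset.mem_univ b)
    rw [z x hx, z y hy]
  | succ n ih =>
    intro ρ γ k x y hx hy hs
    by_cases hs' : ∑ a, ρ a ≤ n
    · exact ih ρ γ k x y hx hy hs'
    have hp : ∃ a, 0 < ρ a := by
      by_contra hcon
      push Not at hcon
      have := Finset.sum_nonpos (s := Finset.univ) (fun a _ => hcon a)
      omega
    obtain ⟨x', y', a0, b0, p1, p2, p3, p4⟩ := tmeet_all hw hn x y hx hy hp
    let e : ι → κ → ℤ := fun a b => (if a = a0 then 1 else 0) * (if b = b0 then 1 else 0)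
    have he : ∀ a b, 0 ≤ e a b := by
      intro a b; simp only [e]; split_ifs <;> simp
    have key : ∀ z, tfib w ρ γ k z → 0 < z a0 b0 →
        tfib w (fun a => ρ a - ∑ b, e a b) (fun b => γ b - ∑ a, e a b)
          (k - ∑ a, ∑ b, w a b * e a b) (fun a b => z a b - e a b) := by
      intro z hz hpos
      refine ⟨fun a b => ?_, fun a => ?_, fun b => ?_, ?_⟩
      · have := hz.nn a b
        simp only [e]
        by_cases c1 : a = a0 <;> by_cases c2 : b = b0 <;> subst_vars <;> simp_all <;> omega
      · rw [Finset.sum_sub_distrib, hz.row]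
      · rw [Finset.sum_sub_distrib, hz.col]
      · simp_rw [mul_sub, Finset.sum_sub_distrib, hz.sub]
    have hc := ih _ _ _ _ _ (key x' (tfib_conn hx p1) p3) (key y' (tfib_conn hy p2) p4) (by
      rw [Finset.sum_sub_distrib]
      simp [e]
      push_cast at hs
      omega)
    have hc' := tconn_add e he hc
    simp only [sub_add_cancel] at hc'
    exact (p1.trans hc').trans (tconn_symm hy p2)

end

lemma basicMove_eq {R C : ℕ} {i i' : Fin R} {j j' : Fin C} (p : Fin R × Fin C) :
    basicMove i i' j j' p = tbm i i' j j' p.1 p.2 := by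
  obtain ⟨a, b⟩ := p
  simp only [basicMove, tbm, Prod.mk.injEq]
  by_cases a = i <;> by_cases a = i' <;> by_cases b = j <;> by_cases b = j' <;> simp_all

lemma sum_S {R C : ℕ} (S : Finset (Fin R × Fin C)) (z : Fin R × Fin C → ℤ) :
    ∑ a, ∑ b, (if (a, b) ∈ S then (1:ℤ) else 0) * z (a, b) = ∑ p ∈ S, z p := by
  rw [← Fintype.sum_prod_type' (f := fun a b => (if (a, b) ∈ S then (1:ℤ) else 0) * z (a, b))]
  simp

lemma conn_list {R C : ℕ} (S : Finset (Fin R × Fin C)) {x y : Fin R → Fin C → ℤ}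
    (hx : ∀ a b, 0 ≤ x a b)
    (h : tconn (fun a b => if (a, b) ∈ S then (1:ℤ) else 0) x y) :
    ∃ (α : ℕ) (B : ℕ → (Fin R × Fin C → ℤ)), (∀ t < α, B t ∈ B0 S) ∧
      (∀ p : Fin R × Fin C, y p.1 p.2 = x p.1 p.2 + ∑ t ∈ Finset.range α, B t p) ∧
      (∀ a ≤ α, ∀ p : Fin R × Fin C, 0 ≤ x p.1 p.2 + ∑ t ∈ Finset.range a, B t p) := by
  induction h with
  | refl =>
    refine ⟨0, fun _ _ => 0, by simp, by simp, ?_⟩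
    intro a _ p
    simpa using hx _ _
  | @tail u v _ h ih =>
    obtain ⟨α, B, h1, h2, h3⟩ := ih
    obtain ⟨i, i', j, j', hi, hj, hw', hn, hh⟩ := h
    have hsum : ∀ a ≤ α, ∀ p, ∑ t ∈ Finset.range a, (if t < α then B t else basicMove i i' j j') p
        = ∑ t ∈ Finset.range a, B t p := by
      intro a ha p
      apply Finset.sum_congr rfl
      intro t ht
      rw [if_pos (lt_of_lt_of_le (Finset.mem_range.1 ht) ha)]
    have hlast : ∀ p : Fin R × Fin C, x p.1 p.2 + ∑ t ∈ Finset.range (α + 1),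
        (if t < α then B t else basicMove i i' j j') p = v p.1 p.2 := by
      intro p
      rw [Finset.sum_range_succ, hsum α le_rfl, ← add_assoc, ← h2, if_neg (lt_irrefl α),
        basicMove_eq, ← hh]
    refine ⟨α + 1, fun t => if t < α then B t else basicMove i i' j j', ?_, ?_, ?_⟩
    · intro t ht
      by_cases hta : t < α
      · simpa [hta] using h1 t hta
      · simp only [hta, if_false]
        refine ⟨i, i', j, j', hi, hj, rfl, ?_, ?_, ?_⟩
        · intro a; simp_rw [basicMove_eq, tbm_row]
        · intro a; simp_rw [basicMove_eq, tbm_col]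
        · rw [← sum_S]
          simp_rw [basicMove_eq]
          rw [tbm_sub (fun a b => if (a, b) ∈ S then (1:ℤ) else 0)]
          linarith
    · intro p; exact (hlast p).symm
    · intro a ha p
      rcases Nat.lt_or_ge α a with h | h
      · obtain rfl : a = α + 1 := by omega
        rw [hlast]; exact hn _ _
      · rw [hsum a h]; exact h3 a h p

/-- If `S` is equivalent to a triangular set, then `B₀(S)` is a Markov basis for `S`. -/
theorem stmt11 {R C : ℕ} (hR : 1 ≤ R) (hC : 1 ≤ C) (S : Finset (Fin R × Fin C))
    (hS : isTriangular S) : isMarkovBasis S (B0 S) := by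
  refine ⟨?_, ?_, ?_, ?_⟩
  · apply (Set.finite_range (fun q : Fin R × Fin R × Fin C × Fin C =>
      basicMove q.1 q.2.1 q.2.2.1 q.2.2.2)).subset
    rintro z ⟨i, i', j, j', _, _, rfl, _⟩
    exact ⟨(i, i', j, j'), rfl⟩
  · rintro z ⟨i, i', j, j', _, _, _, h⟩
    exact h
  · rintro z ⟨i, i', j, j', hi, hj, rfl, h1, h2, h3⟩
    refine ⟨i', i, j, j', hi.symm, hj, ?_, ?_, ?_, ?_⟩
    · funext p
      simp only [Pi.neg_apply, basicMove]; ring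
    · intro i; simp [h1]
    · intro i; simp [h2]
    · simp [h3]
  · intro x y hf hne
    obtain ⟨f1, f2, f3⟩ := hf
    have hx : tfib (fun a b => if (a, b) ∈ S then (1:ℤ) else 0) (fun a => ∑ b, (x (a, b) : ℤ))
        (fun b => ∑ a, (x (a, b) : ℤ)) (∑ p ∈ S, (x p : ℤ)) (fun a b => (x (a, b) : ℤ)) :=
      ⟨fun _ _ => by positivity, fun _ => rfl, fun _ => rfl, sum_S S (fun p => (x p : ℤ))⟩
    have hy : tfib (fun a b => if (a, b) ∈ S then (1:ℤ) else 0) (fun a => ∑ b, (x (a, b) : ℤ))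
        (fun b => ∑ a, (x (a, b) : ℤ)) (∑ p ∈ S, (x p : ℤ)) (fun a b => (y (a, b) : ℤ)) := by
      refine ⟨fun _ _ => by positivity, fun a => ?_, fun b => ?_, ?_⟩
      · exact_mod_cast (f1 a).symm
      · exact_mod_cast (f2 b).symm
      · rw [sum_S S (fun p => (y p : ℤ))]
        exact_mod_cast f3.symm
    have hc := tconn_all (fun a b => by split_ifs <;> simp) (fun a b => by
      rcases hS a b with h | h
      · left
        intro j
        by_cases h1 : (a, j) ∈ S
        · simp [h1, h j h1]
        · simp only [h1, if_false]; split_ifs <;> simp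
      · right
        intro j
        by_cases h1 : (b, j) ∈ S
        · simp [h1, h j h1]
        · simp only [h1, if_false]; split_ifs <;> simp)
      (∑ a, ∑ b, (x (a, b) : ℤ)).toNat _ _ _ _ _ hx hy (Int.self_le_toNat _)
    obtain ⟨α, B, h1, h2, h3⟩ := conn_list S hx.nn hc
    refine ⟨α, B, ?_, h1, fun p => h2 p, fun a _ ha p => h3 a ha p⟩
    rcases Nat.eq_zero_or_pos α with h0 | h0
    · exfalso
      subst h0
      apply hne
      funext p
      have := h2 p
      simp at this
      exact_mod_cast this.symm
    · exact h0
end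

section
/- Let n ≥ 2, R = n, C = n + 1, S = {(i,j) ∈ I : j ≤ i}, and let X ≠ Y be tables in the same S-fiber with Z = X − Y. If there is a row i_a such that z_{i_a,1} and z_{i_a,n+1} are both nonzero and of opposite signs, then ‖X − Y‖₁ can be reduced by B₀(S). -/
open Finset

theorem basic_mem_B0 {n : ℕ} (hn : 2 ≤ n) (a b : Fin n) (hab : a ≠ b) :
    basicMove a b (Fin.last n) 0 ∈ B0 (staircase n) := by
  have h0 : (Fin.last n) ≠ 0 := by
    intro h
    have := congrArg Fin.val h
    simp at this
    omega
  refine ⟨a, b, Fin.last n, 0, hab, h0, rfl, ?_, ?_, ?_⟩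
  · intro i
    simp only [basicMove, Prod.mk.injEq, Finset.sum_add_distrib, Finset.sum_sub_distrib, ite_and]
    by_cases h1 : i = a <;> by_cases h2 : i = b <;> simp [h1, h2]
  · intro j
    simp only [basicMove, Prod.mk.injEq, Finset.sum_add_distrib, Finset.sum_sub_distrib,
      and_comm (a := _ = a), and_comm (a := _ = b), ite_and]
    by_cases h1 : j = 0 <;> by_cases h2 : j = Fin.last n <;> simp [h1, h2]
  · have e1 : ∀ i : Fin n, (i, Fin.last n) ∉ staircase n := by
      intro i
      simp [staircase]
    have e2 : ∀ i : Fin n, (i, (0 : Fin (n + 1))) ∈ staircase n := by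
      intro i
      simp [staircase]
    simp only [basicMove, Finset.sum_add_distrib, Finset.sum_sub_distrib, Finset.sum_ite_eq',
      e1, e2]
    simp

theorem norm_aux {n : ℕ} (hn : 2 ≤ n) (a b : Fin n) (hab : a ≠ b)
    (z : Fin n × Fin (n + 1) → ℤ) (h1 : 0 < z (a, 0)) (h2 : z (a, Fin.last n) < 0)
    (h3 : z (b, 0) < 0) :
    ∑ p, |z p + basicMove a b (Fin.last n) 0 p| < ∑ p, |z p| := by
  have h0 : (Fin.last n) ≠ 0 := by
    intro h
    have := congrArg Fin.val h
    simp at this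
    omega
  have key : ∑ p, |z p + basicMove a b (Fin.last n) 0 p| ≤ ∑ p, (|z p|
      + ((if p = (b, Fin.last n) then 1 else 0) - (if p = (a, 0) then 1 else 0)
        - (if p = (a, Fin.last n) then 1 else 0) - (if p = (b, 0) then 1 else 0))) := by
    apply Finset.sum_le_sum
    intro p _
    unfold basicMove
    by_cases p1 : p = (a, 0)
    · subst p1
      simp [hab, h0.symm]
      grind
    by_cases p2 : p = (a, Fin.last n)
    · subst p2
      simp [hab, h0]
      grind
    by_cases p3 : p = (b, 0)
    · subst p3
      simp [hab.symm, h0.symm]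
      grind
    by_cases p4 : p = (b, Fin.last n)
    · subst p4
      simp [hab.symm, h0]
      grind
    simp [p1, p2, p3, p4]
  refine lt_of_le_of_lt key ?_
  simp only [Finset.sum_add_distrib, Finset.sum_sub_distrib, Finset.sum_ite_eq', Finset.mem_univ]
  simp

/-- Lemma 4: for the staircase set, if some row `i_a` of `Z = X − Y` has nonzero entries of
opposite signs in the first and last columns, then `‖X − Y‖₁` can be reduced by `B₀(S)`. -/
theorem stmt12 (n : ℕ) (hn : 2 ≤ n) (x y : Fin n × Fin (n + 1) → ℕ)
    (hf : sameFiber (staircase n) x y) (hxy : x ≠ y) (ia : Fin n)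
    (h : (0 < (x (ia, 0) : ℤ) - (y (ia, 0) : ℤ) ∧
            (x (ia, Fin.last n) : ℤ) - (y (ia, Fin.last n) : ℤ) < 0) ∨
         ((x (ia, 0) : ℤ) - (y (ia, 0) : ℤ) < 0 ∧
            0 < (x (ia, Fin.last n) : ℤ) - (y (ia, Fin.last n) : ℤ))) :
    normReducible (staircase n) x y := by
  have hz : ∑ i, ((x (i, 0) : ℤ) - (y (i, 0) : ℤ)) = 0 := by
    rw [Finset.sum_sub_distrib, sub_eq_zero]
    exact_mod_cast hf.2.1 0
  rcases h with ⟨h1, h2⟩ | ⟨h1, h2⟩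
  · obtain ⟨b, hb⟩ : ∃ b, (x (b, 0) : ℤ) - (y (b, 0) : ℤ) < 0 := by
      by_contra! hc
      have := Finset.single_le_sum (fun i _ => hc i) (Finset.mem_univ ia)
      omega
    have hab : ia ≠ b := by
      rintro rfl
      omega
    refine ⟨0, 1, fun _ => 0, fun _ => basicMove ia b (Fin.last n) 0, by simp, by simp,
      fun _ _ => basic_mem_B0 hn ia b hab, ?_, ?_, ?_⟩
    · intro t ht ht'
      omega
    · intro t ht ht' p
      obtain rfl : t = 1 := by omega
      simp only [Finset.sum_range_one, basicMove]
      by_cases p2 : p = (ia, Fin.last n)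
      · subst p2
        have : b ≠ ia := hab.symm
        simp [hab]
        split_ifs <;> omega
      by_cases p3 : p = (b, 0)
      · subst p3
        simp [hab.symm]
        split_ifs <;> omega
      simp only [p2, p3]
      split_ifs <;> simp_all <;> omega
    · simpa using norm_aux hn ia b hab (fun p => (x p : ℤ) - (y p : ℤ)) h1 h2 hb
  · obtain ⟨b, hb⟩ : ∃ b, 0 < (x (b, 0) : ℤ) - (y (b, 0) : ℤ) := by
      by_contra! hc
      have := Finset.single_le_sum (f := fun i => -((x (i, 0) : ℤ) - (y (i, 0) : ℤ)))
        (fun i _ => by have := hc i; omega) (Finset.mem_univ ia)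
      rw [Finset.sum_neg_distrib, hz] at this
      omega
    have hab : ia ≠ b := by
      rintro rfl
      omega
    have hneg : ∀ p, basicMove b ia (Fin.last n) 0 p = - basicMove ia b (Fin.last n) 0 p := by
      intro p
      unfold basicMove
      ring
    refine ⟨1, 0, fun _ => basicMove b ia (Fin.last n) 0, fun _ => 0, by simp,
      fun _ _ => basic_mem_B0 hn b ia hab.symm, by simp, ?_, ?_, ?_⟩
    · intro t ht ht' p
      obtain rfl : t = 1 := by omega
      simp only [Finset.sum_range_one, basicMove]
      by_cases p2 : p = (ia, Fin.last n)
      · subst p2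
        simp [hab]
        split_ifs <;> omega
      by_cases p3 : p = (b, 0)
      · subst p3
        simp [hab.symm]
        split_ifs <;> omega
      simp only [p2, p3]
      split_ifs <;> simp_all <;> omega
    · intro t ht ht'
      omega
    · have := norm_aux hn ia b hab (fun p => (y p : ℤ) - (x p : ℤ))
        (by omega) (by omega) (by omega)
      have e1 : ∀ p, |(y p : ℤ) - (x p : ℤ) + basicMove ia b (Fin.last n) 0 p|
          = |(x p : ℤ) - (y p : ℤ) + basicMove b ia (Fin.last n) 0 p| := by
        intro p
        rw [hneg, ← abs_neg]
        congr 1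
        ring
      have e2 : ∀ p, |(y p : ℤ) - (x p : ℤ)| = |(x p : ℤ) - (y p : ℤ)| := fun p => abs_sub_comm _ _
      simp only [e1, e2] at this
      simpa using this
end

section
/- Let n ≥ 2, R = n, C = n + 1, S = {(i,j) ∈ I : j ≤ i}, and let X ≠ Y be tables in the same S-fiber with Z = X − Y. If there exist rows i_a < i_b < i_c such that either z_{i_a,1} > 0, z_{i_b,1} < 0 and z_{i_c,1} > 0, or z_{i_a,1} < 0, z_{i_b,1} > 0 and z_{i_c,1} < 0, then ‖X − Y‖₁ can be reduced by B₀(S). -/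
open Finset

lemma aux_move {n : ℕ} (i b : Fin n) (j k : Fin (n + 1))
    (hS : (if (j : ℕ) ≤ i then (1 : ℤ) else 0) + (if (k : ℕ) ≤ b then 1 else 0)
      - (if (k : ℕ) ≤ i then 1 else 0) - (if (j : ℕ) ≤ b then 1 else 0) = 0) :
    isMove (staircase n) (basicMove i b j k) := by
  refine ⟨fun r => ?_, fun c => ?_, ?_⟩
  · simp only [basicMove, Finset.sum_add_distrib, Finset.sum_sub_distrib, Prod.mk.injEq, ite_and]
    by_cases h1 : r = i <;> by_cases h2 : r = b <;> simp [h1, h2]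
  · simp only [basicMove, Finset.sum_add_distrib, Finset.sum_sub_distrib, Prod.mk.injEq,
      and_comm, ite_and]
    by_cases h1 : c = j <;> by_cases h2 : c = k <;> simp [h1, h2]
  · simp only [basicMove, Finset.sum_add_distrib, Finset.sum_sub_distrib, Finset.sum_ite_eq',
      staircase, Finset.mem_filter, Finset.mem_univ, true_and]
    exact hS

lemma aux_norm {R C : ℕ} (z : Fin R × Fin C → ℤ) (i b : Fin R) (j k : Fin C)
    (hib : i ≠ b) (hjk : j ≠ k) (h1 : 0 < z (i, k)) (h2 : z (b, k) < 0) (h3 : 0 < z (b, j)) :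
    ∑ p, |z p + basicMove i b j k p| < ∑ p, |z p| := by
  have key : ∀ p, |z p + basicMove i b j k p| ≤ |z p| + ((if p = (i, j) then (1 : ℤ) else 0)
      - (if p = (b, k) then 1 else 0)
      - (if p = (i, k) then 1 else 0) - (if p = (b, j) then 1 else 0)) := by
    intro p
    unfold basicMove
    by_cases e1 : p = (i, j)
    · subst e1
      have := abs_add_le (z (i, j)) 1
      simpa [hib, hjk] using this
    by_cases e2 : p = (b, k)
    · subst e2
      simp [hib.symm, hjk.symm]
      rw [abs_of_neg h2, abs_of_nonpos (by omega)]; omega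
    by_cases e3 : p = (i, k)
    · subst e3
      simp [hib, hjk.symm]
      rw [abs_of_pos h1, abs_of_nonneg (by omega)]; omega
    by_cases e4 : p = (b, j)
    · subst e4
      simp [hib.symm, hjk]
      rw [abs_of_pos h3, abs_of_nonneg (by omega)]; omega
    simp [e1, e2, e3, e4]
  refine (Finset.sum_le_sum fun p _ => key p).trans_lt ?_
  simp [Finset.sum_add_distrib, Finset.sum_sub_distrib]

lemma aux_neg {R C : ℕ} (i b : Fin R) (j k : Fin C) (p : Fin R × Fin C) :
    basicMove i b k j p = - basicMove i b j k p := by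
  unfold basicMove; ring

/-- Nonnegativity of the shifted table. -/
lemma aux_nonneg {R C : ℕ} (x : Fin R × Fin C → ℕ) (i b : Fin R) (j k : Fin C)
    (hib : i ≠ b) (h1 : 0 < x (i, k)) (h3 : 0 < x (b, j)) (p : Fin R × Fin C) :
    0 ≤ (x p : ℤ) + basicMove i b j k p := by
  unfold basicMove
  by_cases e3 : p = (i, k)
  · subst e3
    simp [hib]
    split_ifs <;> omega
  by_cases e4 : p = (b, j)
  · subst e4
    simp [hib.symm]
    split_ifs <;> omega
  simp only [e3, e4, if_false]
  split_ifs <;> omega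

lemma aux_red1 {n : ℕ} (x y : Fin n × Fin (n + 1) → ℕ) (i b : Fin n) (j k : Fin (n + 1))
    (hib : i ≠ b) (hjk : j ≠ k)
    (hS : (if (j : ℕ) ≤ i then (1 : ℤ) else 0) + (if (k : ℕ) ≤ b then 1 else 0)
      - (if (k : ℕ) ≤ i then 1 else 0) - (if (j : ℕ) ≤ b then 1 else 0) = 0)
    (h1 : y (i, k) < x (i, k)) (h2 : x (b, k) < y (b, k)) (h3 : y (b, j) < x (b, j)) :
    normReducible (staircase n) x y := by
  refine ⟨1, 0, fun _ => basicMove i b j k, fun _ => 0, by simp,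
    fun t _ => ⟨i, b, j, k, hib, hjk, rfl, aux_move i b j k hS⟩, by simp, ?_, ?_, ?_⟩
  · intro a ha ha' p
    obtain rfl : a = 1 := by omega
    simpa using aux_nonneg x i b j k hib (by omega) (by omega) p
  · intro a ha ha'
    omega
  · simpa using aux_norm (fun p => (x p : ℤ) - y p) i b j k hib hjk
      (by simp; omega) (by simp; omega) (by simp; omega)

lemma aux_symm {R C : ℕ} (S : Finset (Fin R × Fin C)) (x y : Fin R × Fin C → ℕ)
    (h : normReducible S y x) : normReducible S x y := by
  have hneg : ∀ B ∈ B0 S, -B ∈ B0 S := by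
    rintro B ⟨i, b, j, k, hib, hjk, rfl, hm1, hm2, hm3⟩
    refine ⟨i, b, k, j, hib, hjk.symm, ?_, ?_, ?_, ?_⟩
    · funext p; rw [aux_neg, Pi.neg_apply]
    · intro r; simp [hm1 r]
    · intro r; simp [hm2 r]
    · simp [hm3]
  obtain ⟨tp, tm, Bp, Bm, h0, h1, h2, h3, h4, h5⟩ := h
  refine ⟨tm, tp, fun t => -Bm t, fun t => -Bp t, by omega, fun t ht => hneg _ (h2 t ht),
    fun t ht => hneg _ (h1 t ht), ?_, ?_, ?_⟩
  · intro a ha ha' p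
    have := h4 a ha ha' p
    simp only [Pi.neg_apply, Finset.sum_neg_distrib]
    linarith
  · intro a ha ha' p
    have := h3 a ha ha' p
    simp only [Pi.neg_apply, Finset.sum_neg_distrib]
    linarith
  · convert h5 using 1
    · refine Finset.sum_congr rfl fun p _ => ?_
      rw [← abs_neg]
      simp only [Pi.neg_apply, Finset.sum_neg_distrib]
      congr 1; ring
    · exact Finset.sum_congr rfl fun p _ => abs_sub_comm _ _

lemma aux_main {n : ℕ} (x y : Fin n × Fin (n + 1) → ℕ)
    (hr : ∀ i : Fin n, ∑ j, x (i, j) = ∑ j, y (i, j))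
    (ia ib ic : Fin n) (hab : ia < ib) (hbc : ib < ic)
    (ha : y (ia, 0) < x (ia, 0)) (hb : x (ib, 0) < y (ib, 0)) (hc : y (ic, 0) < x (ic, 0)) :
    normReducible (staircase n) x y := by
  obtain ⟨j, hj⟩ : ∃ j, y (ib, j) < x (ib, j) := by
    by_contra! hcon
    exact (Finset.sum_lt_sum (fun j _ => hcon j) ⟨0, Finset.mem_univ _, hb⟩).ne (hr ib)
  have hj0 : j ≠ 0 := by
    rintro rfl; omega
  rw [Fin.lt_def] at hab hbc
  by_cases hcase : (ia : ℕ) < j ∧ (j : ℕ) ≤ ib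
  · refine aux_red1 x y ic ib j 0 (fun h => by subst h; omega) hj0 ?_ hc hb hj
    rw [if_pos (by omega), if_pos (by simp), if_pos (by simp), if_pos (by omega)]; rfl
  · refine aux_red1 x y ia ib j 0 (fun h => by subst h; omega) hj0 ?_ ha hb hj
    simp only [Fin.val_zero, Nat.zero_le, if_true]
    split_ifs <;> omega

/-- Lemma 5: for the staircase set, if three rows `i_a < i_b < i_c` of `Z = X − Y` have
alternating signs in the first column, then `‖X − Y‖₁` can be reduced by `B₀(S)`. -/
theorem stmt13 (n : ℕ) (hn : 2 ≤ n) (x y : Fin n × Fin (n + 1) → ℕ)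
    (hf : sameFiber (staircase n) x y) (hxy : x ≠ y)
    (ia ib ic : Fin n) (hab : ia < ib) (hbc : ib < ic)
    (h : (0 < (x (ia, 0) : ℤ) - (y (ia, 0) : ℤ) ∧
            (x (ib, 0) : ℤ) - (y (ib, 0) : ℤ) < 0 ∧
            0 < (x (ic, 0) : ℤ) - (y (ic, 0) : ℤ)) ∨
         ((x (ia, 0) : ℤ) - (y (ia, 0) : ℤ) < 0 ∧
            0 < (x (ib, 0) : ℤ) - (y (ib, 0) : ℤ) ∧
            (x (ic, 0) : ℤ) - (y (ic, 0) : ℤ) < 0)) :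
    normReducible (staircase n) x y := by
  rcases h with ⟨h1, h2, h3⟩ | ⟨h1, h2, h3⟩
  · exact aux_main x y hf.1 ia ib ic hab hbc (by omega) (by omega) (by omega)
  · exact aux_symm _ x y (aux_main y x (fun i => (hf.1 i).symm) ia ib ic hab hbc
      (by omega) (by omega) (by omega))
end

section
/- Let n ≥ 2, R = n, C = n + 1, S = {(i,j) ∈ I : j ≤ i}, and let X ≠ Y be tables in the same S-fiber with Z = X − Y. Suppose there exist rows i_a, i_b, i_c, i_d with z_{i_a,1} > 0, z_{i_b,n+1} > 0, z_{i_c,1} < 0 and z_{i_d,n+1} < 0, satisfying at least one of: i_a < i_c < i_b, or i_a < i_d < i_b, or i_b < i_c < i_a, or i_b < i_d < i_a. Then ‖X − Y‖₁ can be reduced by B₀(S). -/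
open Finset

lemma basicMove_mem_B0 {R C : ℕ} (S : Finset (Fin R × Fin C)) (i i' : Fin R) (j j' : Fin C)
    (hi : i ≠ i') (hj : j ≠ j') (h1 : (i, j) ∈ S ↔ (i', j) ∈ S)
    (h2 : (i, j') ∈ S ↔ (i', j') ∈ S) : basicMove i i' j j' ∈ B0 S := by
  refine ⟨i, i', j, j', hi, hj, rfl, ?_, ?_, ?_⟩
  · intro k
    simp only [basicMove, Prod.mk.injEq, Finset.sum_add_distrib, Finset.sum_sub_distrib, ite_and]
    by_cases hk : k = i <;> by_cases hk' : k = i' <;> simp [hk, hk']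
  · intro k
    simp only [basicMove, Prod.mk.injEq, Finset.sum_add_distrib, Finset.sum_sub_distrib,
      ite_and]
    by_cases hk : k = j <;> by_cases hk' : k = j' <;> simp [hk, hk']
  · simp only [basicMove, Finset.sum_add_distrib, Finset.sum_sub_distrib, Finset.sum_ite_eq']
    simp only [h1, h2]
    ring

/-- Pointwise bound plus negative total correction gives norm reduction. -/
lemma norm_lt_of_bound {α : Type*} [Fintype α] (w z e : α → ℤ)
    (h : ∀ p, |w p| ≤ |z p| + e p) (he : ∑ p, e p < 0) : ∑ p, |w p| < ∑ p, |z p| := by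
  calc ∑ p, |w p| ≤ ∑ p, (|z p| + e p) := Finset.sum_le_sum (fun p _ => h p)
    _ = ∑ p, |z p| + ∑ p, e p := Finset.sum_add_distrib
    _ < _ := by omega

lemma core {R C : ℕ} (S : Finset (Fin R × Fin C)) (x y : Fin R × Fin C → ℕ)
    (hrow : ∀ i : Fin R, ∑ j : Fin C, x (i, j) = ∑ j : Fin C, y (i, j))
    (a b r : Fin R) (c c' : Fin C) (hab : a ≠ b) (hra : r ≠ a) (hrb : r ≠ b) (hcc : c ≠ c')
    (hc : ∀ i i', (i, c) ∈ S ↔ (i', c) ∈ S) (hc' : ∀ i i', (i, c') ∈ S ↔ (i', c') ∈ S)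
    (ha : y (a, c) < x (a, c)) (hb : y (b, c') < x (b, c')) (hr : x (r, c) < y (r, c))
    (hS : ∀ j, ((r, j) ∈ S ↔ (a, j) ∈ S) ∨ ((r, j) ∈ S ↔ (b, j) ∈ S)) :
    normReducible S x y := by
  classical
  obtain ⟨j, hj⟩ : ∃ j, y (r, j) < x (r, j) := by
    by_contra! hcon
    exact absurd (hrow r) (Finset.sum_lt_sum (fun j _ => hcon j) ⟨c, Finset.mem_univ _, hr⟩).ne
  have hjc : j ≠ c := by rintro rfl; omega
  by_cases hd : (r, j) ∈ S ↔ (a, j) ∈ S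
  · refine ⟨1, 0, fun _ => basicMove r a c j, fun _ => 0, by omega, ?_, by simp, ?_, ?_, ?_⟩
    · intro t _
      exact basicMove_mem_B0 S r a c j hra hjc.symm (hc _ _) hd
    · intro t h1 h2 p
      obtain rfl : t = 1 := by omega
      simp only [Finset.sum_range_one, basicMove]
      have h3 : p = (r, j) → 1 ≤ x p := by rintro rfl; omega
      have h4 : p = (a, c) → 1 ≤ x p := by rintro rfl; omega
      grind
    · intro t h1 h2; omega
    · refine norm_lt_of_bound _ _ (fun p => (if p = (a, j) then 1 else 0)
        - (if p = (r, c) then 1 else 0) - (if p = (r, j) then 1 else 0)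
        - (if p = (a, c) then 1 else 0)) ?_ ?_
      · intro p
        simp only [Finset.sum_range_one, Finset.sum_range_zero, basicMove]
        have h3 : p = (r, j) → y p < x p := by rintro rfl; omega
        have h4 : p = (a, c) → y p < x p := by rintro rfl; omega
        have h5 : p = (r, c) → x p < y p := by rintro rfl; omega
        grind
      · simp [Finset.sum_add_distrib, Finset.sum_sub_distrib]
  · have hd' := (hS j).resolve_left hd
    have hjc' : j ≠ c' := by rintro rfl; exact hd (hc' _ _)
    refine ⟨2, 0, fun t => if t = 0 then basicMove b a c c' else basicMove r b c j, fun _ => 0,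
      by omega, ?_, by simp, ?_, ?_, ?_⟩
    · intro t _
      dsimp only
      split_ifs
      · exact basicMove_mem_B0 S b a c c' hab.symm hcc (hc _ _) (hc' _ _)
      · exact basicMove_mem_B0 S r b c j hrb hjc.symm (hc _ _) hd'
    · intro t h1 h2 p
      have h3 : p = (r, j) → 1 ≤ x p := by rintro rfl; omega
      have h4 : p = (a, c) → 1 ≤ x p := by rintro rfl; omega
      have h5 : p = (b, c') → 1 ≤ x p := by rintro rfl; omega
      obtain rfl | rfl : t = 1 ∨ t = 2 := by omega
      · simp only [Finset.sum_range_one, basicMove, if_true]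
        grind
      · simp only [Finset.sum_range_succ, Finset.sum_range_zero, basicMove, if_true,
          one_ne_zero, if_false]
        grind
    · intro t h1 h2; omega
    · refine norm_lt_of_bound _ _ (fun p => (if p = (b, j) then 1 else 0)
        + (if p = (a, c') then 1 else 0)
        - (if p = (r, c) then 1 else 0) - (if p = (r, j) then 1 else 0)
        - (if p = (a, c) then 1 else 0) - (if p = (b, c') then 1 else 0)) ?_ ?_
      · intro p
        simp only [Finset.sum_range_succ, Finset.sum_range_zero, basicMove, if_true,
          one_ne_zero, if_false]
        have h3 : p = (r, j) → y p < x p := by rintro rfl; omega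
        have h4 : p = (a, c) → y p < x p := by rintro rfl; omega
        have h5 : p = (r, c) → x p < y p := by rintro rfl; omega
        have h6 : p = (b, c') → y p < x p := by rintro rfl; omega
        clear hS hd hd' hc hc' hrow
        grind (splits := 30)
      · simp [Finset.sum_add_distrib, Finset.sum_sub_distrib]

/-- Lemma 6: for the staircase set, if rows `i_a, i_b, i_c, i_d` of `Z = X − Y` satisfy
`z_{i_a,1} > 0`, `z_{i_b,n+1} > 0`, `z_{i_c,1} < 0`, `z_{i_d,n+1} < 0` and one of the four
interleaving conditions, then `‖X − Y‖₁` can be reduced by `B₀(S)`. -/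
theorem stmt14 (n : ℕ) (hn : 2 ≤ n) (x y : Fin n × Fin (n + 1) → ℕ)
    (hf : sameFiber (staircase n) x y) (hxy : x ≠ y)
    (ia ib ic id : Fin n)
    (ha : 0 < (x (ia, 0) : ℤ) - (y (ia, 0) : ℤ))
    (hb : 0 < (x (ib, Fin.last n) : ℤ) - (y (ib, Fin.last n) : ℤ))
    (hc : (x (ic, 0) : ℤ) - (y (ic, 0) : ℤ) < 0)
    (hd : (x (id, Fin.last n) : ℤ) - (y (id, Fin.last n) : ℤ) < 0)
    (horder : (ia < ic ∧ ic < ib) ∨ (ia < id ∧ id < ib) ∨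
              (ib < ic ∧ ic < ia) ∨ (ib < id ∧ id < ia)) :
    normReducible (staircase n) x y := by
  have h0 : ∀ i i' : Fin n, (i, (0 : Fin (n + 1))) ∈ staircase n ↔
      (i', (0 : Fin (n + 1))) ∈ staircase n := by
    intro i i'; simp [staircase]
  have hl : ∀ i i' : Fin n, (i, Fin.last n) ∈ staircase n ↔
      (i', Fin.last n) ∈ staircase n := by
    intro i i'
    have := i.2
    have := i'.2
    simp only [staircase, Finset.mem_filter, Finset.mem_univ, true_and, Fin.val_last]
    omega
  have hne : (0 : Fin (n + 1)) ≠ Fin.last n := by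
    intro h
    have := congrArg Fin.val h
    simp at this
    omega
  have hor : (((ia < ic ∧ ic < ib) ∨ (ib < ic ∧ ic < ia)) ∨
      ((ia < id ∧ id < ib) ∨ (ib < id ∧ id < ia))) := by tauto
  rcases hor with h | h
  · refine core _ x y hf.1 ia ib ic 0 (Fin.last n) (by omega) (by omega) (by omega) hne h0 hl
      (by omega) (by omega) (by omega) ?_
    intro j
    simp only [staircase, Finset.mem_filter, Finset.mem_univ, true_and]
    omega
  · refine core _ x y hf.1 ib ia id (Fin.last n) 0 (by omega) (by omega) (by omega) hne.symm hl h0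
      (by omega) (by omega) (by omega) ?_
    intro j
    simp only [staircase, Finset.mem_filter, Finset.mem_univ, true_and]
    omega
end

section
/- Let n ≥ 2, R = n, C = n + 1, S = {(i,j) ∈ I : j ≤ i}, and let X ≠ Y be tables in the same S-fiber with Z = X − Y. Suppose Z satisfies condition (★) with some threshold i₀, suppose i₁ is a last nonzero boundary row of Z, and suppose there exists a cell (i,j) ∈ S with i ≥ i₁ and z_{ij} > 0. Then ‖X − Y‖₁ can be reduced by B₀(S). -/
open Finset

section Swap
variable {ι κ : Type*}

/-- a weight preserving swap of two pairs -/
def SwStep (w : ι → κ → ℤ) (X Y : Multiset (ι × κ)) : Prop :=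
  ∃ r c r' c' M, X = (r, c) ::ₘ (r', c') ::ₘ M ∧ Y = (r, c') ::ₘ (r', c) ::ₘ M ∧
    w r c + w r' c' = w r c' + w r' c

/-- connectivity by swaps -/
def SwConn (w : ι → κ → ℤ) : Multiset (ι × κ) → Multiset (ι × κ) → Prop :=
  Relation.ReflTransGen (SwStep w)

lemma SwStep.symm {w : ι → κ → ℤ} {X Y : Multiset (ι × κ)} (h : SwStep w X Y) :
    SwStep w Y X := by
  obtain ⟨r, c, r', c', M, h1, h2, h3⟩ := h
  exact ⟨r, c', r', c, M, h2, h1, h3.symm⟩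

lemma SwConn.symm {w : ι → κ → ℤ} {X Y : Multiset (ι × κ)} (h : SwConn w X Y) :
    SwConn w Y X := by
  induction h with
  | refl => exact Relation.ReflTransGen.refl
  | tail _ h2 ih => exact Relation.ReflTransGen.head h2.symm ih

lemma SwConn.cons {w : ι → κ → ℤ} {X Y : Multiset (ι × κ)} (p : ι × κ) (h : SwConn w X Y) :
    SwConn w (p ::ₘ X) (p ::ₘ Y) := by
  induction h with
  | refl => exact Relation.ReflTransGen.refl
  | tail _ h2 ih =>
    refine Relation.ReflTransGen.tail ih ?_
    obtain ⟨r, c, r', c', M, h1, h2, h3⟩ := h2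
    refine ⟨r, c, r', c', p ::ₘ M, ?_, ?_, h3⟩
    · rw [h1, Multiset.cons_swap p, Multiset.cons_swap p]
    · rw [h2, Multiset.cons_swap p, Multiset.cons_swap p]

/-- same margins and same weight -/
def SwEq (w : ι → κ → ℤ) (X Y : Multiset (ι × κ)) : Prop :=
  X.map Prod.fst = Y.map Prod.fst ∧ X.map Prod.snd = Y.map Prod.snd ∧
    (X.map (fun p => w p.1 p.2)).sum = (Y.map (fun p => w p.1 p.2)).sum

lemma SwEq.symm {w : ι → κ → ℤ} {X Y : Multiset (ι × κ)} (h : SwEq w X Y) : SwEq w Y X :=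
  ⟨h.1.symm, h.2.1.symm, h.2.2.symm⟩

lemma SwEq.trans {w : ι → κ → ℤ} {X Y Z : Multiset (ι × κ)} (h : SwEq w X Y)
    (h' : SwEq w Y Z) : SwEq w X Z :=
  ⟨h.1.trans h'.1, h.2.1.trans h'.2.1, h.2.2.trans h'.2.2⟩

lemma SwConn.swEq {w : ι → κ → ℤ} {X Y : Multiset (ι × κ)} (h : SwConn w X Y) : SwEq w X Y := by
  induction h with
  | refl => exact ⟨rfl, rfl, rfl⟩
  | tail _ h2 ih =>
    refine ih.trans ?_
    obtain ⟨r, c, r', c', M, h1, h2, h3⟩ := h2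
    subst h1 h2
    refine ⟨by simp, by simp [Multiset.cons_swap c c'], ?_⟩
    simp only [Multiset.map_cons, Multiset.sum_cons]
    linarith

/-- staircase indicator -/
def stI (a b : ℤ) : ℤ := if b ≤ a then 1 else 0

/-- `w` is a staircase indicator up to row and column functions on the used rows/columns. -/
def SwGood (w : ι → κ → ℤ) (X : Multiset (ι × κ)) (ρ : ι → ℤ) (γ : κ → ℤ) (f : ι → ℤ)
    (g : κ → ℤ) : Prop :=
  ∀ r ∈ X.map Prod.fst, ∀ c ∈ X.map Prod.snd, w r c = stI (ρ r) (γ c) + f r + g c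

lemma SwGood.of_eq {w : ι → κ → ℤ} {X Y : Multiset (ι × κ)} {ρ : ι → ℤ} {γ : κ → ℤ} {f : ι → ℤ}
    {g : κ → ℤ} (h : SwGood w X ρ γ f g) (e : SwEq w X Y) : SwGood w Y ρ γ f g := by
  unfold SwGood at *
  rw [← e.1, ← e.2.1]; exact h

lemma finite_bdd {α : Type*} (s : Multiset α) (h : α → ℤ) :
    ∃ A B : ℤ, ∀ a ∈ s, A ≤ h a ∧ h a ≤ B := by
  induction s using Multiset.induction_on with
  | empty => exact ⟨0, 0, by simp⟩
  | cons a s ih =>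
    obtain ⟨A, B, hAB⟩ := ih
    refine ⟨min A (h a), max B (h a), ?_⟩
    intro b hb
    rcases Multiset.mem_cons.1 hb with rfl | hb
    · simp
    · have := hAB b hb
      exact ⟨by omega, by omega⟩

lemma exists_argmin {α : Type*} (s : Multiset α) (hs : s ≠ 0) (h : α → ℤ) :
    ∃ a ∈ s, ∀ b ∈ s, h a ≤ h b := by
  classical
  obtain ⟨a0, ha0⟩ := Multiset.exists_mem_of_ne_zero hs
  obtain ⟨a, ha, hb⟩ := s.toFinset.exists_min_image h ⟨a0, by simpa using ha0⟩
  exact ⟨a, by simpa using ha, fun b hb' => hb b (by simpa using hb')⟩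

/-- Rotation: one may assume that some used column precedes all rows, and
some used row succeeds all columns. -/
lemma rotate {w : ι → κ → ℤ} {X : Multiset (ι × κ)} {ρ : ι → ℤ} {γ : κ → ℤ} {f : ι → ℤ}
    {g : κ → ℤ} (h : SwGood w X ρ γ f g) (hX : X ≠ 0) :
    ∃ ρ' γ' f' g', SwGood w X ρ' γ' f' g' ∧
      (∃ c0 ∈ X.map Prod.snd, ∀ r ∈ X.map Prod.fst, γ' c0 ≤ ρ' r) ∧
      (∃ r0 ∈ X.map Prod.fst, ∀ c ∈ X.map Prod.snd, γ' c ≤ ρ' r0) := by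
  classical
  unfold SwGood at *
  have hU : X.map Prod.fst ≠ 0 := by simpa using hX
  have hV : X.map Prod.snd ≠ 0 := by simpa using hX
  generalize X.map Prod.fst = U at *
  generalize X.map Prod.snd = V at *
  obtain ⟨u0, hu0⟩ := Multiset.exists_mem_of_ne_zero hU
  obtain ⟨v0, hv0⟩ := Multiset.exists_mem_of_ne_zero hV
  obtain ⟨_, B, hB⟩ := finite_bdd V γ
  let ρ' : ι → ℤ := fun r => if ∃ c ∈ V, γ c ≤ ρ r then ρ r else B
  obtain ⟨A, _, hA⟩ := finite_bdd U ρ'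
  let γ' : κ → ℤ := fun c => if ∃ r ∈ U, γ c ≤ ρ' r then γ c else A
  have h1 : ∀ r ∈ U, ∃ c ∈ V, γ' c ≤ ρ' r := by
    intro r hr
    have : ∃ c ∈ V, γ c ≤ ρ' r := by
      by_cases hc : ∃ c ∈ V, γ c ≤ ρ r
      · obtain ⟨c, hc1, hc2⟩ := hc
        refine ⟨c, hc1, ?_⟩
        simp only [ρ']
        rw [if_pos ⟨c, hc1, hc2⟩]; exact hc2
      · refine ⟨v0, hv0, ?_⟩
        simp only [ρ']
        rw [if_neg hc]; exact (hB v0 hv0).2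
    obtain ⟨c, hc1, hc2⟩ := this
    refine ⟨c, hc1, ?_⟩
    simp only [γ']
    rw [if_pos ⟨r, hr, hc2⟩]; exact hc2
  have h2 : ∀ c ∈ V, ∃ r ∈ U, γ' c ≤ ρ' r := by
    intro c hc
    by_cases hr : ∃ r ∈ U, γ c ≤ ρ' r
    · obtain ⟨r, hr1, hr2⟩ := hr
      refine ⟨r, hr1, ?_⟩
      simp only [γ']
      rw [if_pos ⟨r, hr1, hr2⟩]; exact hr2
    · refine ⟨u0, hu0, ?_⟩
      simp only [γ']
      rw [if_neg hr]; exact (hA u0 hu0).1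
  refine ⟨ρ', γ', fun r => f r - (if ∃ c ∈ V, γ c ≤ ρ r then 0 else 1),
    fun c => g c - (if ∃ r ∈ U, γ c ≤ ρ' r then 0 else 1), ?_, ?_, ?_⟩
  · intro r hr c hc
    have e1 : stI (ρ' r) (γ c) = stI (ρ r) (γ c) + (if ∃ c ∈ V, γ c ≤ ρ r then 0 else 1) := by
      by_cases hh : ∃ c ∈ V, γ c ≤ ρ r
      · simp only [ρ', if_pos hh, add_zero]
      · simp only [ρ', if_neg hh, stI]
        rw [if_pos (hB c hc).2, if_neg (fun h => hh ⟨c, hc, h⟩)]; rfl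
    have e2 : stI (ρ' r) (γ' c) = stI (ρ' r) (γ c) +
        (if ∃ r ∈ U, γ c ≤ ρ' r then 0 else 1) := by
      by_cases hh : ∃ r ∈ U, γ c ≤ ρ' r
      · simp only [γ', if_pos hh, add_zero]
      · simp only [γ', if_neg hh, stI]
        rw [if_pos (hA r hr).1, if_neg (fun h => hh ⟨r, hr, h⟩)]; rfl
    rw [h r hr c hc, e2, e1]; ring
  · obtain ⟨c0, hc0, hm⟩ := exists_argmin V hV γ'
    refine ⟨c0, hc0, fun r hr => ?_⟩
    obtain ⟨c, hc, hcr⟩ := h1 r hr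
    exact (hm c hc).trans hcr
  · obtain ⟨r0, hr0, hm⟩ := exists_argmin U hU (fun r => - ρ' r)
    refine ⟨r0, hr0, fun c hc => ?_⟩
    obtain ⟨r, hr, hcr⟩ := h2 c hc
    have := hm r hr
    omega

/-- the certificate bound -/
def stCert (X : Multiset (ι × κ)) (ρ : ι → ℤ) (γ : κ → ℤ) (t : ℤ) : Prop :=
  ∀ p ∈ X, stI (ρ p.1) (γ p.2) = 1 - stI t (ρ p.1) + stI t (γ p.2)

lemma stI_le (a b t : ℤ) : 0 ≤ 1 - stI t a + stI t b - stI a b := by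
  unfold stI; split_ifs <;> omega

lemma sum_zero_mem {α : Type*} (s : Multiset α) (h : α → ℤ) (h0 : ∀ a, 0 ≤ h a)
    (hs : (s.map h).sum = 0) : ∀ a ∈ s, h a = 0 := by
  induction s using Multiset.induction_on with
  | empty => simp
  | cons a s ih =>
    have h1 : 0 ≤ (s.map h).sum := Multiset.sum_nonneg (by
      intro x hx; obtain ⟨b, _, rfl⟩ := Multiset.mem_map.1 hx; exact h0 b)
    have h2 := h0 a
    simp only [Multiset.map_cons, Multiset.sum_cons] at hs
    intro b hb
    rcases Multiset.mem_cons.1 hb with rfl | hb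
    · omega
    · exact ih (by omega) b hb

lemma sum_slack {w : ι → κ → ℤ} {X : Multiset (ι × κ)} {ρ : ι → ℤ} {γ : κ → ℤ} {f : ι → ℤ}
    {g : κ → ℤ} (h : SwGood w X ρ γ f g) (t : ℤ) :
    (X.map (fun p => 1 - stI t (ρ p.1) + stI t (γ p.2) - stI (ρ p.1) (γ p.2))).sum =
      ((X.map Prod.fst).map (fun r => 1 - stI t (ρ r) + f r)).sum +
      ((X.map Prod.snd).map (fun c => stI t (γ c) + g c)).sum -
      (X.map (fun p => w p.1 p.2)).sum := by
  rw [Multiset.map_map, Multiset.map_map, ← Multiset.sum_map_add, ← Multiset.sum_map_sub]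
  congr 1
  refine Multiset.map_congr rfl fun p hp => ?_
  rw [h p.1 (Multiset.mem_map_of_mem _ hp) p.2 (Multiset.mem_map_of_mem _ hp)]
  simp only [Function.comp]
  ring

lemma stCert.transfer {w : ι → κ → ℤ} {X Y : Multiset (ι × κ)} {ρ : ι → ℤ} {γ : κ → ℤ}
    {f : ι → ℤ} {g : κ → ℤ} (h : SwGood w X ρ γ f g) (e : SwEq w X Y) {t : ℤ}
    (hc : stCert X ρ γ t) : stCert Y ρ γ t := by
  have h1 := sum_slack h t
  have h2 := sum_slack (h.of_eq e) t
  rw [← e.1, ← e.2.1, ← e.2.2, ← h1] at h2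
  have h3 : (X.map (fun p => 1 - stI t (ρ p.1) + stI t (γ p.2) - stI (ρ p.1) (γ p.2))).sum = 0 := by
    refine Multiset.sum_eq_zero fun x hx => ?_
    obtain ⟨p, hp, rfl⟩ := Multiset.mem_map.1 hx
    have := hc p hp
    omega
  rw [h3] at h2
  intro p hp
  have := sum_zero_mem Y _ (fun p => stI_le (ρ p.1) (γ p.2) t) h2 p hp
  omega

lemma phase1 {w : ι → κ → ℤ} {ρ : ι → ℤ} {γ : κ → ℤ} {f : ι → ℤ} {g : κ → ℤ} {r0 : ι} {c0 : κ}
    (k : ℕ) : ∀ (c' : κ) (r' : ι) (M : Multiset (ι × κ)),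
    (γ c' - ρ r').toNat ≤ k →
    SwGood w ((r0, c') ::ₘ (r', c0) ::ₘ M) ρ γ f g →
    (∀ r ∈ ((r0, c') ::ₘ (r', c0) ::ₘ M).map Prod.fst, γ c0 ≤ ρ r) →
    (∀ c ∈ ((r0, c') ::ₘ (r', c0) ::ₘ M).map Prod.snd, γ c ≤ ρ r0) →
    (∃ X', SwConn w ((r0, c') ::ₘ (r', c0) ::ₘ M) ((r0, c0) ::ₘ X')) ∨
    ∃ t, (∃ r ∈ ((r0, c') ::ₘ (r', c0) ::ₘ M).map Prod.fst, ρ r ≤ t) ∧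
      stCert ((r0, c') ::ₘ (r', c0) ::ₘ M) ρ γ t := by
  classical
  induction k using Nat.strong_induction_on with
  | _ k ih =>
  intro c' r' M hk hg h1 h2
  by_cases hle : γ c' ≤ ρ r'
  · left
    refine ⟨(r', c') ::ₘ M, Relation.ReflTransGen.single ⟨r0, c', r', c0, M, rfl, rfl, ?_⟩⟩
    rw [hg r0 (by simp) c' (by simp), hg r' (by simp) c0 (by simp), hg r0 (by simp) c0 (by simp),
      hg r' (by simp) c' (by simp)]
    simp only [stI]
    rw [if_pos (h2 c' (by simp)), if_pos (h1 r' (by simp)), if_pos (h1 r0 (by simp)), if_pos hle]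
    ring
  -- general continuation
  have key : ∀ (c'' : κ) (r'' : ι) (N : Multiset (ι × κ)),
      SwStep w ((r0, c') ::ₘ (r', c0) ::ₘ M) ((r0, c'') ::ₘ (r'', c0) ::ₘ N) →
      γ c'' - ρ r'' < γ c' - ρ r' →
      (∃ X', SwConn w ((r0, c') ::ₘ (r', c0) ::ₘ M) ((r0, c0) ::ₘ X')) ∨
      ∃ t, (∃ r ∈ ((r0, c') ::ₘ (r', c0) ::ₘ M).map Prod.fst, ρ r ≤ t) ∧
        stCert ((r0, c') ::ₘ (r', c0) ::ₘ M) ρ γ t := by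
    intro c'' r'' N hs hlt
    have hcn : SwConn w _ _ := Relation.ReflTransGen.single hs
    have e := hcn.swEq
    have hg' := hg.of_eq e
    rcases ih (γ c'' - ρ r'').toNat (by omega) c'' r'' N le_rfl hg' (by rw [← e.1]; exact h1)
      (by rw [← e.2.1]; exact h2) with ⟨X', hX'⟩ | ⟨t, ht, hc⟩
    · exact Or.inl ⟨X', hcn.trans hX'⟩
    · refine Or.inr ⟨t, ?_, hc.transfer hg' e.symm⟩
      rw [e.1]; exact ht
  by_cases hm1 : ∃ p ∈ M, ρ r' < ρ p.1 ∧ stI (ρ p.1) (γ p.2) = stI (ρ r') (γ p.2)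
  · obtain ⟨⟨r'', c''⟩, hp, hlt, heq⟩ := hm1
    obtain ⟨N, rfl⟩ := Multiset.exists_cons_of_mem hp
    simp only at hlt heq
    refine key c' r'' ((r', c'') ::ₘ (N)) ⟨r', c0, r'', c'', (r0, c') ::ₘ N, ?_, ?_, ?_⟩ (by omega)
    · rw [Multiset.cons_swap (r0, c'), Multiset.cons_swap (r0, c')]
    · rw [Multiset.cons_swap (r0, c'), Multiset.cons_swap (r'', c0), Multiset.cons_swap (r0, c'),
        Multiset.cons_swap (r0, c'), Multiset.cons_swap (r'', c0)]
    · rw [hg r' (by simp) c0 (by simp), hg r'' (by simp) c'' (by simp),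
        hg r' (by simp) c'' (by simp), hg r'' (by simp) c0 (by simp), heq]
      simp only [stI]
      rw [if_pos (h1 r' (by simp)), if_pos (h1 r'' (by simp))]
      ring
  by_cases hm2 : ∃ p ∈ M, γ p.2 < γ c' ∧ stI (ρ p.1) (γ p.2) = stI (ρ p.1) (γ c')
  · obtain ⟨⟨r'', c''⟩, hp, hlt, heq⟩ := hm2
    obtain ⟨N, rfl⟩ := Multiset.exists_cons_of_mem hp
    simp only at hlt heq
    refine key c'' r' ((r'', c') ::ₘ (N)) ⟨r0, c', r'', c'', (r', c0) ::ₘ N, ?_, ?_, ?_⟩ (by omega)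
    · rw [Multiset.cons_swap (r', c0)]
    · rw [Multiset.cons_swap (r', c0)]
    · rw [hg r0 (by simp) c' (by simp), hg r'' (by simp) c'' (by simp),
        hg r0 (by simp) c'' (by simp), hg r'' (by simp) c' (by simp), heq]
      simp only [stI]
      rw [if_pos (h2 c' (by simp)), if_pos (h2 c'' (by simp))]
      ring
  right
  refine ⟨ρ r', ⟨r', by simp, le_rfl⟩, ?_⟩
  push Not at hm1 hm2
  intro p hp
  rcases Multiset.mem_cons.1 hp with rfl | hp
  · have := h2 c' (by simp)
    simp only [stI]
    split_ifs <;> omega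
  rcases Multiset.mem_cons.1 hp with rfl | hp
  · have := h1 r' (by simp)
    simp only [stI]
    split_ifs <;> omega
  have a1 := hm1 p hp
  have a2 := hm2 p hp
  unfold stI at *
  by_cases q1 : ρ r' < ρ p.1 <;> by_cases q2 : γ p.2 < γ c' <;>
    simp only [q1, q2, true_implies, false_implies] at a1 a2 <;> split_ifs at * <;> omega

lemma exists_pair [DecidableEq ι] [DecidableEq κ] {X : Multiset (ι × κ)} {r : ι} {c : κ}
    (hr : r ∈ X.map Prod.fst) (hc : c ∈ X.map Prod.snd) :
    (∃ M, X = (r, c) ::ₘ M) ∨ ∃ c' r' M, X = (r, c') ::ₘ (r', c) ::ₘ M := by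
  obtain ⟨⟨r1, c'⟩, h1, h1'⟩ := Multiset.mem_map.1 hr
  obtain ⟨⟨r', c1⟩, h2, h2'⟩ := Multiset.mem_map.1 hc
  simp only at h1' h2'
  subst h1' h2'
  obtain ⟨M, rfl⟩ := Multiset.exists_cons_of_mem h1
  rcases Multiset.mem_cons.1 h2 with h | h
  · simp only [Prod.mk.injEq] at h
    left
    exact ⟨M, by rw [h.2]⟩
  · obtain ⟨N, rfl⟩ := Multiset.exists_cons_of_mem h
    exact Or.inr ⟨c', r', N, rfl⟩

lemma phase2 {w : ι → κ → ℤ} {X : Multiset (ι × κ)} {ρ : ι → ℤ} {γ : κ → ℤ} {f : ι → ℤ}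
    {g : κ → ℤ} {rs : ι} {c0 : κ} {t : ℤ} (hg : SwGood w X ρ γ f g)
    (h1 : ∀ r ∈ X.map Prod.fst, γ c0 ≤ ρ r) (hmin : ∀ r ∈ X.map Prod.fst, ρ rs ≤ ρ r)
    (hrs : rs ∈ X.map Prod.fst) (hc0 : c0 ∈ X.map Prod.snd) (ht : ρ rs ≤ t)
    (hc : stCert X ρ γ t) : ∃ X', SwConn w X ((rs, c0) ::ₘ X') := by
  classical
  rcases exists_pair hrs hc0 with ⟨M, rfl⟩ | ⟨c', r', M, rfl⟩
  · exact ⟨M, Relation.ReflTransGen.refl⟩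
  · refine ⟨(r', c') ::ₘ M, Relation.ReflTransGen.single ⟨rs, c', r', c0, M, rfl, rfl, ?_⟩⟩
    rw [hg rs (by simp) c' (by simp), hg r' (by simp) c0 (by simp), hg rs (by simp) c0 (by simp),
      hg r' (by simp) c' (by simp)]
    have a1 := hc (rs, c') (by simp)
    have a2 := hc (r', c0) (by simp)
    have a3 := h1 rs (by simp)
    have a4 := h1 r' (by simp)
    have a5 := hmin r' (by simp)
    unfold stI at *
    simp only at a1 a2
    split_ifs at * <;> omega

theorem swap_connected (w : ι → κ → ℤ) (k : ℕ) : ∀ (X Y : Multiset (ι × κ)) (ρ : ι → ℤ)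
    (γ : κ → ℤ) (f : ι → ℤ) (g : κ → ℤ), X.card = k → SwEq w X Y → SwGood w X ρ γ f g →
    SwConn w X Y := by
  classical
  induction k with
  | zero =>
    intro X Y ρ γ f g hk e _
    have hX : X = 0 := by simpa using hk
    have hY : Y = 0 := by
      have := e.1
      rw [hX] at this
      simpa using this.symm
    rw [hX, hY]; exact Relation.ReflTransGen.refl
  | succ k ih =>
    intro X Y ρ γ f g hk e hg
    have hX : X ≠ 0 := by rintro rfl; simp at hk
    obtain ⟨ρ, γ, f, g, hg, ⟨c0, hc0, h1⟩, ⟨r0, hr0, h2⟩⟩ := rotate hg hX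
    -- finishing from common cell
    have fin : ∀ p, (∃ X', SwConn w X (p ::ₘ X')) → (∃ Y', SwConn w Y (p ::ₘ Y')) →
        SwConn w X Y := by
      rintro p ⟨X', hX'⟩ ⟨Y', hY'⟩
      have e1 := (hX'.swEq.symm.trans e).trans hY'.swEq
      have hgX := hg.of_eq hX'.swEq
      have hcard : X'.card = k := by
        have := congrArg Multiset.card hX'.swEq.1
        simp at this
        omega
      have e2 : SwEq w X' Y' := by
        obtain ⟨a, b, c⟩ := e1
        simp only [Multiset.map_cons, Multiset.sum_cons] at a b c
        exact ⟨(Multiset.cons_inj_right _).1 a, (Multiset.cons_inj_right _).1 b, by linarith⟩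
      have hgX' : SwGood w X' ρ γ f g := by
        intro r hr c hc
        refine hgX r ?_ c ?_ <;> rw [Multiset.map_cons] <;>
          exact Multiset.mem_cons_of_mem (by assumption)
      have := ih X' Y' ρ γ f g hcard e2 hgX'
      exact (hX'.trans (this.cons p)).trans hY'.symm
    have ph : ∀ Z, SwEq w X Z → (∃ Z', SwConn w Z ((r0, c0) ::ₘ Z')) ∨
        ∃ t, (∃ r ∈ X.map Prod.fst, ρ r ≤ t) ∧ stCert X ρ γ t := by
      intro Z eZ
      have hgZ := hg.of_eq eZ
      have q1 := h1
      have q2 := h2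
      rw [eZ.1] at hr0 q1
      rw [eZ.2.1] at hc0 q2
      rcases exists_pair hr0 hc0 with ⟨M, hM⟩ | ⟨c', r', M, hM⟩
      · exact Or.inl ⟨M, by rw [hM]; exact Relation.ReflTransGen.refl⟩
      · rw [hM] at hgZ q1 q2
        rcases phase1 _ c' r' M le_rfl hgZ q1 q2 with h | ⟨t, ht, hc⟩
        · left; rw [hM]; exact h
        · right
          refine ⟨t, ?_, ?_⟩
          · rw [eZ.1, hM]; exact ht
          · rw [← hM] at hc hgZ
            exact hc.transfer hgZ eZ.symm
    have certc : (∃ t, (∃ r ∈ X.map Prod.fst, ρ r ≤ t) ∧ stCert X ρ γ t) → SwConn w X Y := by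
      rintro ⟨t, ⟨r, hr, hrt⟩, hc⟩
      obtain ⟨rs, hrs, hmin⟩ := exists_argmin (X.map Prod.fst) (by simpa using hX) ρ
      have hst := (hmin r hr).trans hrt
      refine fin (rs, c0) (phase2 hg h1 hmin hrs hc0 hst hc) ?_
      exact phase2 (hg.of_eq e) (by rw [← e.1]; exact h1) (by rw [← e.1]; exact hmin)
        (by rw [← e.1]; exact hrs) (by rw [← e.2.1]; exact hc0) hst (hc.transfer hg e)
    rcases ph X ⟨rfl, rfl, rfl⟩ with hx | hx
    · rcases ph Y e with hy | hy
      · exact fin _ hx hy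
      · exact certc hy
    · exact certc hx

end Swap

lemma basicMove_isMove {n : ℕ} (r r' : Fin n) (c c' : Fin (n + 1))
    (h : stI (r : ℕ) (c : ℕ) + stI (r' : ℕ) (c' : ℕ) = stI (r : ℕ) (c' : ℕ) + stI (r' : ℕ) (c : ℕ)) :
    isMove (staircase n) (basicMove r r' c' c) := by
  refine ⟨fun a => ?_, fun b => ?_, ?_⟩
  · simp only [basicMove, Finset.sum_sub_distrib, Finset.sum_add_distrib, Prod.mk.injEq, ite_and]
    by_cases h1 : a = r <;> by_cases h2 : a = r' <;> simp [h1, h2]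
  · simp only [basicMove, Finset.sum_sub_distrib, Finset.sum_add_distrib, Prod.mk.injEq, ite_and]
    simp
  · simp only [basicMove, Finset.sum_sub_distrib, Finset.sum_add_distrib, Finset.sum_ite_eq']
    simp only [stI, Nat.cast_le] at h
    simp only [staircase, Finset.mem_filter, Finset.mem_univ, true_and]
    linarith

/-- the multiset of a table -/
def tabM {α : Type*} [Fintype α] (x : α → ℕ) : Multiset α := ∑ p, x p • ({p} : Multiset α)

lemma tabM_count {α : Type*} [Fintype α] [DecidableEq α] (x : α → ℕ) (p : α) :
    (tabM x).count p = x p := by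
  unfold tabM
  rw [Multiset.count_sum']
  simp [Multiset.count_nsmul, Multiset.count_singleton]

lemma tabM_map {α β : Type*} [Fintype α] (x : α → ℕ) (h : α → β) :
    (tabM x).map h = ∑ p, x p • ({h p} : Multiset β) := by
  unfold tabM
  rw [← Multiset.coe_mapAddMonoidHom, map_sum]
  simp [Multiset.map_nsmul]

lemma path_of_conn {n : ℕ} (x : Fin n × Fin (n + 1) → ℕ) (Y : Multiset (Fin n × Fin (n + 1)))
    (h : SwConn (fun (r : Fin n) (c : Fin (n + 1)) => stI (r : ℕ) (c : ℕ)) (tabM x) Y) :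
    ∃ (τ : ℕ) (B : ℕ → (Fin n × Fin (n + 1) → ℤ)), (∀ t < τ, B t ∈ B0 (staircase n)) ∧
      (∀ a ≤ τ, ∀ p, 0 ≤ (x p : ℤ) + ∑ t ∈ Finset.range a, B t p) ∧
      ∀ p, (Y.count p : ℤ) = (x p : ℤ) + ∑ t ∈ Finset.range τ, B t p := by
  induction h with
  | refl =>
    refine ⟨0, fun _ _ => 0, by simp, ?_, ?_⟩
    · intro a ha p; simp
    · intro p; simp [tabM_count]
  | @tail Y Z _ h2 ih =>
    obtain ⟨τ, B, hB, hnn, hY⟩ := ih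
    obtain ⟨r, c, r', c', M, h1, h2, h3⟩ := h2
    by_cases hr : r = r'
    · subst hr
      rw [Multiset.cons_swap, ← h1] at h2
      subst h2
      exact ⟨τ, B, hB, hnn, hY⟩
    by_cases hc : c = c'
    · subst hc
      rw [← h1] at h2
      subst h2
      exact ⟨τ, B, hB, hnn, hY⟩
    have hsum : ∀ a ≤ τ, ∀ p, ∑ t ∈ Finset.range a,
        (if t < τ then B t else basicMove r r' c' c) p = ∑ t ∈ Finset.range a, B t p := by
      intro a ha p
      refine Finset.sum_congr rfl fun t ht => ?_
      rw [if_pos (by have := Finset.mem_range.1 ht; omega)]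
    have hZ : ∀ p, (Z.count p : ℤ) = (x p : ℤ) + ∑ t ∈ Finset.range (τ + 1),
        (if t < τ then B t else basicMove r r' c' c) p := by
      intro p
      rw [Finset.sum_range_succ, hsum τ le_rfl, if_neg (lt_irrefl _), ← add_assoc, ← hY, h1, h2]
      simp only [Multiset.count_cons, basicMove]
      push_cast
      ring
    refine ⟨τ + 1, fun t => if t < τ then B t else basicMove r r' c' c, ?_, ?_, hZ⟩
    · intro t _
      simp only
      split_ifs with hlt
      · exact hB t hlt
      · exact ⟨r, r', c', c, hr, fun h => hc h.symm, rfl, basicMove_isMove r r' c c' h3⟩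
    · intro a ha p
      rcases Nat.lt_or_ge τ a with hlt | hge
      · have : a = τ + 1 := by omega
        subst this
        rw [← hZ]; positivity
      · rw [hsum a hge]; exact hnn a hge p

theorem reducible_of_fiber (n : ℕ) (x y : Fin n × Fin (n + 1) → ℕ)
    (hf : sameFiber (staircase n) x y) (hxy : x ≠ y) : normReducible (staircase n) x y := by
  have he : SwEq (fun (r : Fin n) (c : Fin (n + 1)) => stI (r : ℕ) (c : ℕ)) (tabM x) (tabM y) := by
    obtain ⟨h1, h2, h3⟩ := hf
    refine ⟨?_, ?_, ?_⟩
    · rw [tabM_map, tabM_map, Fintype.sum_prod_type, Fintype.sum_prod_type]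
      refine Finset.sum_congr rfl fun i _ => ?_
      simp only
      rw [← Finset.sum_smul, ← Finset.sum_smul, h1]
    · rw [tabM_map, tabM_map, Fintype.sum_prod_type_right, Fintype.sum_prod_type_right]
      refine Finset.sum_congr rfl fun i _ => ?_
      simp only
      rw [← Finset.sum_smul, ← Finset.sum_smul, h2]
    · have key : ∀ u : Fin n × Fin (n + 1) → ℕ,
          ((tabM u).map (fun p => stI ((p.1 : ℕ) : ℤ) ((p.2 : ℕ) : ℤ))).sum
            = ((∑ p ∈ staircase n, u p : ℕ) : ℤ) := by
        intro u
        rw [tabM_map, ← Multiset.coe_sumAddMonoidHom, map_sum]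
        simp [staircase, Finset.sum_filter, stI, Multiset.sum_nsmul]
      rw [key, key, h3]
  have hconn := swap_connected _ _ (tabM x) (tabM y) (fun r => ((r : ℕ) : ℤ))
    (fun c => ((c : ℕ) : ℤ)) (fun _ => 0) (fun _ => 0) rfl he (by intro r _ c _; simp)
  obtain ⟨τ, B, hB, hnn, hY⟩ := path_of_conn x _ hconn
  simp only [tabM_count] at hY
  have hτ : 0 < τ := by
    rcases Nat.eq_zero_or_pos τ with rfl | h
    · exfalso; apply hxy; funext p
      have := hY p
      simp at this
      exact this.symm
    · exact h
  refine ⟨τ, 0, B, fun _ _ => 0, by omega, hB, by simp, fun a _ ha p => hnn a ha p, ?_, ?_⟩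
  · intro a h1 h2; omega
  · have h0 : ∀ p, (x p : ℤ) - y p + ∑ t ∈ Finset.range τ, B t p
        + ∑ t ∈ Finset.range 0, (0 : ℤ) = 0 := by
      intro p; rw [hY p]; simp
    have h00 : ∀ p, |(x p : ℤ) - y p + ∑ t ∈ Finset.range τ, B t p
        + ∑ t ∈ Finset.range 0, (fun (_ : ℕ) (_ : Fin n × Fin (n + 1)) => (0 : ℤ)) t p| = 0 := by
      intro p; rw [abs_eq_zero]; exact h0 p
    rw [Finset.sum_congr rfl (fun p _ => h00 p), Finset.sum_const_zero]
    obtain ⟨p, hp⟩ := Function.ne_iff.1 hxy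
    refine Finset.sum_pos' (fun p _ => abs_nonneg _) ⟨p, Finset.mem_univ _, ?_⟩
    rw [abs_pos]; omega

/-- Lemma 7: for the staircase set, if `Z = X − Y` satisfies condition (★) with threshold
`i₀`, `i₁` is a last nonzero boundary row of `Z`, and some cell of `S` in a row `≥ i₁` is
positive, then `‖X − Y‖₁` can be reduced by `B₀(S)`. -/
theorem stmt15 (n : ℕ) (hn : 2 ≤ n) (x y : Fin n × Fin (n + 1) → ℕ)
    (hf : sameFiber (staircase n) x y) (hxy : x ≠ y) (i₀ i₁ : Fin n)
    (hstar : starCond (fun p => (x p : ℤ) - (y p : ℤ)) i₀)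
    (hlast : lastBoundaryRow (fun p => (x p : ℤ) - (y p : ℤ)) i₁)
    (i : Fin n) (j : Fin (n + 1)) (hij : (i, j) ∈ staircase n) (hi : i₁ ≤ i)
    (hpos : 0 < (x (i, j) : ℤ) - (y (i, j) : ℤ)) :
    normReducible (staircase n) x y := by
  exact reducible_of_fiber n x y hf hxy
end

section
/- Let n ≥ 2, R = n, C = n + 1, S = {(i,j) ∈ I : j ≤ i}, and let z be a move for S. Suppose z satisfies condition (★) with some threshold i₀, that i₁ is a last nonzero boundary row of z, and that z_{ij} ≤ 0 for every cell (i,j) ∈ S with i ≥ i₁. Then |z_{i₁,1} + z_{i₁,n+1}| ≤ Σ |z_{ij}|, where the sum ranges over all cells (i,j) with i < i₁, j ≠ n+1, (i,j) ∉ S (equivalently j > i), and z_{ij} < 0. -/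
open Finset

/-- Lemma 8: for the staircase set, if a move `z` satisfies condition (★), `i₁` is a last
nonzero boundary row, and `z ≤ 0` on all cells of `S` in rows `≥ i₁`, then
`|z_{i₁,1} + z_{i₁,n+1}|` is at most the sum of `|z_{ij}|` over the negative cells of `Sᶜ`
above row `i₁` and away from the last column. -/
theorem stmt16 (n : ℕ) (hn : 2 ≤ n) (z : Fin n × Fin (n + 1) → ℤ)
    (hz : isMove (staircase n) z) (i₀ i₁ : Fin n)
    (hstar : starCond z i₀) (hlast : lastBoundaryRow z i₁)
    (hneg : ∀ p ∈ staircase n, i₁ ≤ p.1 → z p ≤ 0) :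
    |z (i₁, 0) + z (i₁, Fin.last n)| ≤
      ∑ p ∈ Finset.univ.filter (fun p : Fin n × Fin (n + 1) =>
        p.1 < i₁ ∧ (p.1 : ℕ) < (p.2 : ℕ) ∧ p.2 ≠ Fin.last n ∧ z p < 0), |z p| := by
  obtain ⟨hrow, hcol, hS⟩ := hz
  obtain ⟨h0, hL, -, hafter⟩ := hlast
  set b : Fin n → ℤ := fun i => ∑ j : Fin (n + 1),
    if i < i₁ ∧ (i : ℕ) < (j : ℕ) ∧ j ≠ Fin.last n ∧ z (i, j) < 0 then |z (i, j)| else 0 with hb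
  set s : Fin n → ℤ := fun i => ∑ j : Fin (n + 1),
    if (j : ℕ) ≤ (i : ℕ) then z (i, j) else 0 with hs
  have hsum_s : ∑ i, s i = 0 := by
    rw [← hS, staircase, Finset.sum_filter, Fintype.sum_prod_type]
  rw [Finset.sum_filter, Fintype.sum_prod_type]
  change _ ≤ ∑ i, b i
  have hbnn : ∀ i, 0 ≤ b i := fun i => Finset.sum_nonneg fun j _ => by
    split_ifs
    · exact abs_nonneg _
    · exact le_rfl
  have hsneg : ∀ i, i₁ ≤ i → s i ≤ z (i, 0) := by
    intro i hi
    have hle : ∀ j : Fin (n + 1), (if (j : ℕ) ≤ (i : ℕ) then z (i, j) else 0) ≤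
        if j = 0 then z (i, 0) else 0 := by
      intro j
      by_cases hj : j = 0
      · subst hj
        simp
      · rw [if_neg hj]
        split_ifs with h
        · exact hneg (i, j) (by simp [staircase, h]) hi
        · exact le_rfl
    calc s i ≤ ∑ j : Fin (n + 1), if j = 0 then z (i, 0) else 0 :=
          Finset.sum_le_sum fun j _ => hle j
      _ = z (i, 0) := by simp
  have key : ∀ i, 0 ≤ -s i - z (i, Fin.last n) +
      (if i = i₁ then z (i₁, 0) + z (i₁, Fin.last n) else 0) + b i := by
    intro i
    rcases lt_trichotomy i i₁ with h | h | h
    · rw [if_neg h.ne]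
      have hlt : z (i, Fin.last n) =
          ∑ j : Fin (n + 1), if j = Fin.last n then z (i, j) else 0 := by simp
      have e : -s i - z (i, Fin.last n) + 0 + b i = ∑ j : Fin (n + 1),
          (z (i, j) - (if (j : ℕ) ≤ (i : ℕ) then z (i, j) else 0)
            - (if j = Fin.last n then z (i, j) else 0)
            + if i < i₁ ∧ (i : ℕ) < (j : ℕ) ∧ j ≠ Fin.last n ∧ z (i, j) < 0
              then |z (i, j)| else 0) := by
        rw [Finset.sum_add_distrib, Finset.sum_sub_distrib, Finset.sum_sub_distrib,
          hrow, ← hlt]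
        simp only [hs, hb]
        ring
      rw [e]
      refine Finset.sum_nonneg fun j _ => ?_
      by_cases hj : j = Fin.last n
      · subst hj
        have : ¬ n ≤ (i : ℕ) := by omega
        simp [this]
      · by_cases hji : (j : ℕ) ≤ (i : ℕ)
        · simp [hj, hji, not_lt.mpr hji]
        · by_cases hzn : z (i, j) < 0
          · rw [if_neg hji, if_neg hj, if_pos ⟨h, not_le.mp hji, hj, hzn⟩, abs_of_neg hzn]
            simp
          · rw [if_neg hji, if_neg hj, if_neg (fun hc => hzn hc.2.2.2)]
            simpa using hzn
    · subst h
      have := hsneg i le_rfl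
      have := hbnn i
      rw [if_pos rfl]
      linarith
    · have h1 := hsneg i h.le
      have h2 := hbnn i
      obtain ⟨h3, h4⟩ := hafter i h
      rw [if_neg h.ne', h4]
      linarith
  have tot := Finset.sum_nonneg fun i (_ : i ∈ Finset.univ) => key i
  rw [Finset.sum_add_distrib, Finset.sum_add_distrib, Finset.sum_sub_distrib,
    Finset.sum_neg_distrib, hsum_s, hcol] at tot
  simp only [Finset.sum_ite_eq', Finset.mem_univ, if_true] at tot
  rw [abs_of_nonpos (by linarith)]
  linarith
end

section
/- Let n ≥ 2, R = n, C = n + 1, S = {(i,j) ∈ I : j ≤ i}, and let X ≠ Y be tables in the same S-fiber with Z = X − Y. Suppose Z satisfies condition (★) with some threshold i₀, that i₁ = 3 is a last nonzero boundary row of Z, and that z_{ij} ≤ 0 for every cell (i,j) ∈ S with i ≥ 3. Then ‖X − Y‖₁ can be reduced by B₀(S). -/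
open Finset

lemma basicMove_isMove_s18 {R C : ℕ} (S : Finset (Fin R × Fin C)) (a b : Fin R) (c j : Fin C)
    (h1 : (a, c) ∈ S ↔ (b, c) ∈ S) (h2 : (a, j) ∈ S ↔ (b, j) ∈ S) :
    isMove S (basicMove a b c j) := by
  refine ⟨fun i => ?_, fun k => ?_, ?_⟩
  · simp only [basicMove, Finset.sum_add_distrib, Finset.sum_sub_distrib, Prod.mk.injEq, ite_and]
    by_cases h : i = a <;> by_cases h' : i = b <;> simp [h, h']
  · simp only [basicMove, Finset.sum_add_distrib, Finset.sum_sub_distrib, Prod.mk.injEq,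
      and_comm (b := k = _), ite_and]
    by_cases h : k = c <;> by_cases h' : k = j <;> simp [h, h']
  · simp only [basicMove, Finset.sum_add_distrib, Finset.sum_sub_distrib, Finset.sum_ite_eq',
      h1, h2]
    ring

lemma reduce_three {R C : ℕ} (S : Finset (Fin R × Fin C)) (x y : Fin R × Fin C → ℕ)
    (a b : Fin R) (c j : Fin C) (hab : a ≠ b) (hcj : c ≠ j)
    (h1 : (a, c) ∈ S ↔ (b, c) ∈ S) (h2 : (a, j) ∈ S ↔ (b, j) ∈ S)
    (hac : (x (a, c) : ℤ) - y (a, c) < 0) (haj : 0 < (x (a, j) : ℤ) - y (a, j))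
    (hbc : 0 < (x (b, c) : ℤ) - y (b, c)) : normReducible S x y := by
  refine ⟨1, 0, fun _ => basicMove a b c j, fun _ => 0, by norm_num, ?_, ?_, ?_, ?_, ?_⟩
  · intro t _
    exact ⟨a, b, c, j, hab, hcj, rfl, basicMove_isMove_s18 S a b c j h1 h2⟩
  · intro t ht
    omega
  · intro t ht ht' p
    obtain rfl : t = 1 := by omega
    simp only [Finset.sum_range_one, basicMove]
    by_cases e1 : p = (a, j)
    · subst e1
      simp [hab, hcj.symm]
      omega
    by_cases e2 : p = (b, c)
    · subst e2
      simp [hab.symm, hcj]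
      omega
    simp only [e1, e2, if_false]
    split_ifs <;> omega
  · intro t ht ht'
    omega
  · have key : ∀ p, |(x p : ℤ) - y p + basicMove a b c j p| ≤ |(x p : ℤ) - y p| +
        ((if p = (b, j) then 1 else 0) - (if p = (a, c) then 1 else 0)
          - (if p = (a, j) then 1 else 0) - (if p = (b, c) then 1 else 0)) := by
      intro p
      simp only [basicMove]
      by_cases e1 : p = (a, j)
      · subst e1
        simp [hab, hcj.symm]
        simp only [abs_eq_max_neg]; omega
      by_cases e2 : p = (b, c)
      · subst e2
        simp [hab.symm, hcj]
        simp only [abs_eq_max_neg]; omega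
      by_cases e3 : p = (a, c)
      · subst e3
        simp [hab, hcj]
        simp only [abs_eq_max_neg]; omega
      simp only [e1, e2, e3, if_false]
      split_ifs <;> simp only [abs_eq_max_neg] <;> omega
    have hs := Finset.sum_le_sum (s := Finset.univ) fun p _ => key p
    simp only [Finset.sum_add_distrib, Finset.sum_sub_distrib, Finset.sum_ite_eq',
      Finset.mem_univ, if_true] at hs
    simp only [Finset.sum_range_one, Finset.sum_range_zero, add_zero]
    omega

/-- A finite sum that vanishes and has a negative term has a positive term. -/
lemma exists_pos_term {ι : Type*} [Fintype ι] (f : ι → ℤ) (h : ∑ i, f i = 0) (k : ι)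
    (hk : f k < 0) : ∃ i, 0 < f i := by
  by_contra! hc
  have := Finset.sum_lt_sum (s := Finset.univ) (f := f) (g := fun _ => 0)
    (fun i _ => hc i) ⟨k, Finset.mem_univ _, hk⟩
  simp [h] at this

/-- Lemma 9 (ii): for the staircase set, if `Z = X − Y` satisfies condition (★), the row
`i₁ = 3` (in 1-based numbering) is a last nonzero boundary row, and `Z ≤ 0` on all cells of
`S` in rows `≥ i₁`, then `‖X − Y‖₁` can be reduced by `B₀(S)`. -/
theorem stmt18 (n : ℕ) (hn : 2 ≤ n) (x y : Fin n × Fin (n + 1) → ℕ)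
    (hf : sameFiber (staircase n) x y) (hxy : x ≠ y) (i₀ i₁ : Fin n)
    (hi₁ : (i₁ : ℕ) + 1 = 3)
    (hstar : starCond (fun p => (x p : ℤ) - (y p : ℤ)) i₀)
    (hlast : lastBoundaryRow (fun p => (x p : ℤ) - (y p : ℤ)) i₁)
    (hneg : ∀ p ∈ staircase n, i₁ ≤ p.1 → (x p : ℤ) - (y p : ℤ) ≤ 0) :
    normReducible (staircase n) x y := by
  have hrow : ∀ i, ∑ j, ((x (i, j) : ℤ) - y (i, j)) = 0 := by
    intro i
    have := hf.1 i
    rw [Finset.sum_sub_distrib, sub_eq_zero]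
    exact_mod_cast this
  have hcol : ∀ j, ∑ i, ((x (i, j) : ℤ) - y (i, j)) = 0 := by
    intro j
    have := hf.2.1 j
    rw [Finset.sum_sub_distrib, sub_eq_zero]
    exact_mod_cast this
  obtain ⟨l1, l2, l3, l4⟩ := hlast
  simp only at l1 l2 l3 l4
  -- it suffices to treat one boundary column `c`
  have main : ∀ c : Fin (n + 1), (c = 0 ∨ c = Fin.last n) →
      (x (i₁, c) : ℤ) - y (i₁, c) < 0 → normReducible (staircase n) x y := by
    intro c hc hlt
    obtain ⟨j, hj⟩ := exists_pos_term _ (hrow i₁) c hlt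
    obtain ⟨b, hb⟩ := exists_pos_term _ (hcol c) i₁ hlt
    have hjc : c ≠ j := by
      rintro rfl
      omega
    have hab : i₁ ≠ b := by
      rintro rfl
      omega
    have hbi : b < i₁ := by
      by_contra hcon
      have hgt : i₁ < b := lt_of_le_of_ne (not_lt.mp hcon) hab
      have := l4 b hgt
      rcases hc with rfl | rfl <;> omega
    have hjS : (i₁ : ℕ) < (j : ℕ) := by
      by_contra hcon
      have := hneg (i₁, j) (by simp [staircase]; omega) le_rfl
      omega
    have hbi' : (b : ℕ) < i₁ := hbi
    refine reduce_three _ x y i₁ b c j hab hjc ?_ ?_ hlt hj hb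
    · rcases hc with rfl | rfl
      · simp [staircase]
      · have := i₁.2
        have := b.2
        simp only [staircase, Finset.mem_filter, Finset.mem_univ, true_and, Fin.val_last]
        omega
    · simp only [staircase, Finset.mem_filter, Finset.mem_univ, true_and]
      omega
  rcases l3 with h | h
  · exact main 0 (Or.inl rfl) h
  · exact main _ (Or.inr rfl) h
end

section
/- Let J be a nonempty proper subset of the columns {1,…,C} and let S = {(i,j) ∈ I : j ∈ J} be the corresponding union of complete columns (a 1×2 triangular set). Then B₀(S) is a Markov basis for S. -/
open Finset

lemma basicMove_isMove_s19 {R C : ℕ} (J : Finset (Fin C)) (i i' : Fin R) (j j' : Fin C) :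
    isMove ((Finset.univ : Finset (Fin R)) ×ˢ J) (basicMove i i' j j') := by
  have hcol : ∀ l : Fin C, ∑ k : Fin R, basicMove i i' j j' (k, l) = 0 := by
    intro l
    simp only [basicMove, Finset.sum_sub_distrib, Finset.sum_add_distrib, Prod.mk.injEq,
      ite_and]
    simp
  refine ⟨?_, hcol, ?_⟩
  · intro k
    have e : ∀ a : Fin R, ∀ b : Fin C,
        ∑ l : Fin C, (if (k, l) = (a, b) then (1 : ℤ) else 0) = if k = a then 1 else 0 := by
      intro a b
      by_cases h : k = a <;> simp [h]
    simp only [basicMove, Finset.sum_sub_distrib, Finset.sum_add_distrib, e]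
    ring
  · rw [Finset.sum_product_right]
    exact Finset.sum_eq_zero fun l _ => hcol l

lemma connect_aux {R C : ℕ} (J : Finset (Fin C)) (N : ℕ) :
    ∀ x y : Fin R × Fin C → ℕ,
      (∀ i : Fin R, ∑ j : Fin C, ((x (i, j) : ℤ) - y (i, j)) = 0) →
      (∀ j : Fin C, ∑ i : Fin R, ((x (i, j) : ℤ) - y (i, j)) = 0) →
      ∑ p, |(x p : ℤ) - y p| ≤ N →
    ∃ (α : ℕ) (B : ℕ → (Fin R × Fin C → ℤ)),
      (∀ t < α, B t ∈ B0 ((Finset.univ : Finset (Fin R)) ×ˢ J)) ∧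
      (∀ p, (y p : ℤ) = (x p : ℤ) + ∑ t ∈ Finset.range α, B t p) ∧
      (∀ a, a ≤ α → ∀ p, 0 ≤ (x p : ℤ) + ∑ t ∈ Finset.range a, B t p) := by
  induction N with
  | zero =>
    intro x y _ _ hN
    refine ⟨0, fun _ _ => 0, by simp, ?_, by simp⟩
    intro p
    have h0 := Finset.single_le_sum (f := fun p => |(x p : ℤ) - y p|)
      (fun q _ => abs_nonneg _) (Finset.mem_univ p)
    have h1 : |(x p : ℤ) - y p| = 0 := le_antisymm (by simpa using h0.trans hN) (abs_nonneg _)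
    have := abs_eq_zero.1 h1
    simp; omega
  | succ N ih =>
    intro x y hr hc hN
    by_cases hxy : ∃ p, 0 < (x p : ℤ) - y p
    · obtain ⟨⟨i, j⟩, h1⟩ := hxy
      obtain ⟨j', h2⟩ : ∃ j', (x (i, j') : ℤ) - y (i, j') < 0 := by
        by_contra! h
        have := (Finset.sum_eq_zero_iff_of_nonneg (fun l _ => h l)).1 (hr i) j (Finset.mem_univ j)
        omega
      obtain ⟨i', h3⟩ : ∃ i', 0 < (x (i', j') : ℤ) - y (i', j') := by
        by_contra! h
        have := (Finset.sum_eq_zero_iff_of_nonpos (fun l _ => h l)).1 (hc j') i (Finset.mem_univ i)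
        omega
      have hj : j ≠ j' := by rintro rfl; omega
      have hi : i ≠ i' := by rintro rfl; omega
      have hB : basicMove i i' j' j ∈ B0 ((Finset.univ : Finset (Fin R)) ×ˢ J) :=
        ⟨i, i', j', j, hi, hj.symm, rfl, basicMove_isMove_s19 _ _ _ _ _⟩
      have key : ∀ p, 0 ≤ (x p : ℤ) + basicMove i i' j' j p ∧
          |(x p : ℤ) + basicMove i i' j' j p - y p| ≤ |(x p : ℤ) - y p|
            - (if p = (i, j) then 1 else 0) - (if p = (i, j') then 1 else 0)
            - (if p = (i', j') then 1 else 0) + (if p = (i', j) then 1 else 0) := by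
        intro p
        have n1 : ((i, j) : Fin R × Fin C) ≠ (i, j') := by simp [hj]
        have n2 : ((i, j) : Fin R × Fin C) ≠ (i', j') := by simp [hj]
        have n3 : ((i, j) : Fin R × Fin C) ≠ (i', j) := by simp [hi]
        have n4 : ((i, j') : Fin R × Fin C) ≠ (i', j') := by simp [hi]
        have n5 : ((i, j') : Fin R × Fin C) ≠ (i', j) := by simp [hi]
        have n6 : ((i', j') : Fin R × Fin C) ≠ (i', j) := by simp [hj.symm]
        unfold basicMove
        by_cases p1 : p = (i, j)
        · subst p1; simp only [n1, n2, n3, if_true, if_false]; grind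
        by_cases p2 : p = (i, j')
        · subst p2; simp only [n1.symm, n4, n5, if_true, if_false]; grind
        by_cases p3 : p = (i', j')
        · subst p3; simp only [n2.symm, n4.symm, n6, if_true, if_false]; grind
        by_cases p4 : p = (i', j)
        · subst p4; simp only [n3.symm, n5.symm, n6.symm, if_true, if_false]; grind
        simp [p1, p2, p3, p4]
      have hx' : ∀ p, ((((x p : ℤ) + basicMove i i' j' j p).toNat : ℕ) : ℤ)
          = (x p : ℤ) + basicMove i i' j' j p := fun p => Int.toNat_of_nonneg (key p).1
      have hm := basicMove_isMove_s19 J i i' j' j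
      obtain ⟨α, B, b1, b2, b3⟩ := ih (fun p => ((x p : ℤ) + basicMove i i' j' j p).toNat) y
        (by
          intro k
          simp only [hx', add_sub_right_comm]
          rw [Finset.sum_add_distrib, hr k, hm.1 k]; rfl)
        (by
          intro k
          simp only [hx', add_sub_right_comm]
          rw [Finset.sum_add_distrib, hc k, hm.2.1 k]; rfl)
        (by
          simp only [hx']
          have := Finset.sum_le_sum (s := Finset.univ) (fun p _ => (key p).2)
          simp only [Finset.sum_sub_distrib, Finset.sum_add_distrib, Finset.sum_ite_eq',
            Finset.sum_ite_eq, Finset.mem_univ, if_true] at this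
          push_cast at hN
          linarith)
      simp only [hx'] at b2 b3
      refine ⟨α + 1, fun t => Nat.casesOn t (basicMove i i' j' j) B, ?_, ?_, ?_⟩
      · rintro (_ | t) ht
        · exact hB
        · exact b1 t (by omega)
      · intro p
        rw [Finset.sum_range_succ']
        have := b2 p
        rw [add_assoc, add_comm (basicMove i i' j' j p)] at this
        exact this
      · rintro (_ | a) ha p
        · simp
        · rw [Finset.sum_range_succ']
          have := b3 a (by omega) p
          rw [add_assoc, add_comm (basicMove i i' j' j p)] at this
          exact this
    · push Not at hxy
      refine ⟨0, fun _ _ => 0, by simp, ?_, by simp⟩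
      rintro ⟨i, j⟩
      have := (Finset.sum_eq_zero_iff_of_nonpos (fun l _ => hxy (i, l))).1 (hr i) j
        (Finset.mem_univ j)
      simp; omega

/-- For `S` a union of complete columns indexed by a nonempty proper set `J` of columns
(a 1×2 triangular set), `B₀(S)` is a Markov basis for `S`. -/
theorem stmt19 (R C : ℕ) (hR : 1 ≤ R) (hC : 1 ≤ C) (J : Finset (Fin C))
    (hne : J.Nonempty) (hproper : J ≠ Finset.univ) :
    isMarkovBasis ((Finset.univ : Finset (Fin R)) ×ˢ J)
      (B0 ((Finset.univ : Finset (Fin R)) ×ˢ J)) := by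
  refine ⟨?_, ?_, ?_, ?_⟩
  · refine (Set.finite_range
      (fun q : Fin R × Fin R × Fin C × Fin C => basicMove q.1 q.2.1 q.2.2.1 q.2.2.2)).subset ?_
    rintro z ⟨i, i', j, j', -, -, rfl, -⟩
    exact ⟨(i, i', j, j'), rfl⟩
  · rintro z ⟨i, i', j, j', -, -, -, h⟩
    exact h
  · rintro z ⟨i, i', j, j', hi, hj, rfl, -⟩
    have e : -basicMove i i' j j' = basicMove i i' j' j := by
      funext p
      simp only [basicMove, Pi.neg_apply]
      ring
    rw [e]
    exact ⟨i, i', j', j, hi, hj.symm, rfl, basicMove_isMove_s19 _ _ _ _ _⟩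
  · rintro x y ⟨hr, hc, -⟩ hxy
    obtain ⟨α, B, b1, b2, b3⟩ := connect_aux J (∑ p, |(x p : ℤ) - y p|).toNat x y
      (by
        intro i
        rw [Finset.sum_sub_distrib]
        exact sub_eq_zero.2 (by exact_mod_cast hr i))
      (by
        intro j
        rw [Finset.sum_sub_distrib]
        exact sub_eq_zero.2 (by exact_mod_cast hc j))
      (Int.self_le_toNat _)
    refine ⟨α, B, ?_, b1, b2, fun a _ ha => b3 a ha⟩
    rcases Nat.eq_zero_or_pos α with rfl | h
    · exfalso
      apply hxy
      funext p
      have := b2 p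
      simp at this
      exact this.symm
    · exact h
end
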